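/- arXiv:math/0405272 — 2 statements merged into one kernel-verified Lean document; each statement's English description precedes it below -/
import Mathlib

section
/- For all integers m, n, p, q with 1 < m < n and 1 < p < q, the Baumslag–Solitar groups BS(m,n) and BS(p,q) are quasi-isometric. -/
/-- A map `f` between two sets equipped with distance-like functions is a
quasi-isometry: it quasi-preserves distances and has coarsely dense image. -/
def IsQuasiIsometry {X Y : Type*} (d₁ : X → X → ℝ) (d₂ : Y → Y → ℝ) (f : X → Y) : Prop :=
  ∃ K C : ℝ, 1 ≤ K ∧ 0 ≤ C ∧
    (∀ x x' : X, d₁ x x' / K - C ≤ d₂ (f x) (f x') ∧ d₂ (f x) (f x') ≤ K * d₁ x x' + C) ∧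
    (∀ y : Y, ∃ x : X, d₂ y (f x) ≤ C)

/-- The word metric on a group `G` with respect to a generating set `S`:
`wordDist S g h` is the least length of a word in `S ∪ S⁻¹` representing `g⁻¹ * h`. -/
noncomputable def wordDist {G : Type*} [Group G] (S : Set G) (g h : G) : ℝ :=
  ((sInf {n : ℕ | ∃ l : List G, l.length = n ∧ (∀ x ∈ l, x ∈ S ∨ x⁻¹ ∈ S) ∧
      l.prod = g⁻¹ * h} : ℕ) : ℝ)

/-- Two groups are quasi-isometric if, for some finite generating sets, there is a
quasi-isometry between them with respect to the corresponding word metrics. -/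
def QuasiIsometricGroups (G H : Type*) [Group G] [Group H] : Prop :=
  ∃ (S : Finset G) (T : Finset H),
    Subgroup.closure (S : Set G) = ⊤ ∧ Subgroup.closure (T : Set H) = ⊤ ∧
    ∃ f : G → H, IsQuasiIsometry (wordDist (S : Set G)) (wordDist (T : Set H)) f

/-- The single relator `x y^m x⁻¹ y⁻ⁿ` of the Baumslag–Solitar group. -/
def BSRels (m n : ℤ) : Set (FreeGroup (Fin 2)) :=
  {FreeGroup.of 0 * FreeGroup.of 1 ^ m * (FreeGroup.of 0)⁻¹ * (FreeGroup.of 1 ^ n)⁻¹}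

/-- The Baumslag–Solitar group `BS(m,n) = ⟨x, y | x y^m x⁻¹ = y^n⟩`. -/
abbrev BS (m n : ℤ) : Type := PresentedGroup (BSRels m n)

/-! ### Word metrics and coarse correspondences -/

/-- `Reach S k g h`: one gets from `g` to `h` by at most `k` right multiplications by elements of
`S ∪ S⁻¹`. -/
def Reach {G : Type*} [Group G] (S : Set G) (k : ℕ) (g h : G) : Prop :=
  ∃ l : List G, l.length ≤ k ∧ (∀ x ∈ l, x ∈ S ∨ x⁻¹ ∈ S) ∧ g * l.prod = h

namespace Reach

variable {G : Type*} [Group G] {S : Set G}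

theorem refl (k : ℕ) (g : G) : Reach S k g g := ⟨[], by simp, by simp, by simp⟩

theorem mono {k l : ℕ} (hkl : k ≤ l) {g h : G} (H : Reach S k g h) : Reach S l g h := by
  obtain ⟨w, hw, hS, rfl⟩ := H
  exact ⟨w, hw.trans hkl, hS, rfl⟩

theorem trans {k l : ℕ} {g h j : G} (H : Reach S k g h) (H' : Reach S l h j) :
    Reach S (k + l) g j := by
  obtain ⟨w, hw, hS, rfl⟩ := H
  obtain ⟨w', hw', hS', rfl⟩ := H'
  refine ⟨w ++ w', by simp; omega, fun x hx => ?_, by simp [mul_assoc]⟩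
  rcases List.mem_append.1 hx with hx | hx
  exacts [hS x hx, hS' x hx]

theorem symm {k : ℕ} {g h : G} (H : Reach S k g h) : Reach S k h g := by
  obtain ⟨w, hw, hS, rfl⟩ := H
  refine ⟨(w.map (·⁻¹)).reverse, by simpa using hw, fun x hx => ?_, ?_⟩
  · simp only [List.mem_reverse, List.mem_map] at hx
    obtain ⟨y, hy, rfl⟩ := hx
    simpa using (hS y hy).symm
  · rw [← List.prod_inv_reverse]; group

theorem mul_right {s : G} (hs : s ∈ S) (g : G) : Reach S 1 g (g * s) :=
  ⟨[s], by simp, by simp [hs], by simp⟩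

theorem mul_pow {s : G} (hs : s ∈ S) (g : G) (k : ℕ) : Reach S k g (g * s ^ k) := by
  induction k with
  | zero => simpa using refl 0 g
  | succ k ih =>
    rw [pow_succ, ← mul_assoc]
    exact ih.trans (mul_right hs _)

theorem mul_zpow {s : G} (hs : s ∈ S) (g : G) (k : ℤ) : Reach S k.natAbs g (g * s ^ k) := by
  obtain ⟨n, rfl | rfl⟩ := k.eq_nat_or_neg
  · simpa using mul_pow hs g n
  · have := (mul_pow hs (g * s ^ (-(n : ℤ))) n).symm
    simpa using this

theorem wordDist_le {k : ℕ} {g h : G} (H : Reach S k g h) : wordDist S g h ≤ k := by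
  obtain ⟨w, hw, hS, rfl⟩ := H
  unfold wordDist
  have hle : sInf {n : ℕ | ∃ l : List G, l.length = n ∧ (∀ x ∈ l, x ∈ S ∨ x⁻¹ ∈ S) ∧
      l.prod = g⁻¹ * (g * w.prod)} ≤ w.length := Nat.sInf_le ⟨w, rfl, hS, by group⟩
  exact_mod_cast hle.trans hw

theorem exists_wordDist (hS : Subgroup.closure S = ⊤) (g h : G) :
    ∃ k : ℕ, wordDist S g h = k ∧ Reach S k g h := by
  have hne : {n : ℕ | ∃ l : List G, l.length = n ∧ (∀ x ∈ l, x ∈ S ∨ x⁻¹ ∈ S) ∧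
      l.prod = g⁻¹ * h}.Nonempty := by
    have hmem : g⁻¹ * h ∈ (Subgroup.closure S).toSubmonoid := by rw [hS]; trivial
    rw [Subgroup.closure_toSubmonoid] at hmem
    obtain ⟨l, hl, hp⟩ := Submonoid.exists_list_of_mem_closure hmem
    exact ⟨_, l, rfl, hl, hp⟩
  obtain ⟨l, hl, hlS, hp⟩ := Nat.sInf_mem hne
  exact ⟨_, rfl, l, hl.le, hlS, by rw [hp]; group⟩

/-- A correspondence that moves by at most `B` along each generator moves by at most
`B * (k + 1)` along a word of length `k`. -/
theorem of_correspondence {H : Type*} [Group H] {T : Set H} {R : G → H → Prop}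
    (htot : ∀ g, ∃ h, R g h) {B : ℕ}
    (hR : ∀ g g' h h', (g' = g ∨ ∃ s ∈ S, g' = g * s) → R g h → R g' h' → Reach T B h h')
    {k : ℕ} {g g' : G} {h h' : H} (hg : Reach S k g g') (hh : R g h) (hh' : R g' h') :
    Reach T (B * (k + 1)) h h' := by
  obtain ⟨l, hl, hS, rfl⟩ := hg
  refine mono (Nat.mul_le_mul_left B (Nat.add_le_add_right hl 1)) ?_
  clear hl
  induction l generalizing g h with
  | nil => exact (hR _ _ _ _ (Or.inl (by simp)) hh hh').mono (by simp)
  | cons x l ih =>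
    obtain ⟨h₁, hh₁⟩ := htot (g * x)
    have hstep : Reach T B h h₁ := by
      rcases hS x (by simp) with hx | hx
      · exact hR _ _ _ _ (Or.inr ⟨x, hx, rfl⟩) hh hh₁
      · exact (hR _ _ _ _ (Or.inr ⟨x⁻¹, hx, by group⟩) hh₁ hh).symm
    have htail := ih hh₁ (fun y hy => hS y (by simp [hy])) (by simpa [mul_assoc] using hh')
    exact (hstep.trans htail).mono (by simp; ring_nf; rfl)

end Reach

/-- Two groups admitting a coarsely Lipschitz correspondence are quasi-isometric. -/
theorem QuasiIsometricGroups.of_correspondence {G H : Type*} [Group G] [Group H] (S : Finset G)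
    (T : Finset H) (hS : Subgroup.closure (S : Set G) = ⊤)
    (hT : Subgroup.closure (T : Set H) = ⊤) (R : G → H → Prop)
    (htot : ∀ g, ∃ h, R g h) (htot' : ∀ h, ∃ g, R g h) (B : ℕ)
    (hR : ∀ g g' h h', (g' = g ∨ ∃ s ∈ (S : Set G), g' = g * s) → R g h → R g' h' →
      Reach (T : Set H) B h h')
    (hR' : ∀ h h' g g', (h' = h ∨ ∃ s ∈ (T : Set H), h' = h * s) → R g h → R g' h' →
      Reach (S : Set G) B g g') :
    QuasiIsometricGroups G H := by
  choose f hf using htot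
  refine ⟨S, T, hS, hT, f, B + 1, B + 1, by simp, by positivity, fun g g' => ⟨?_, ?_⟩, ?_⟩
  · obtain ⟨k, hk, hreach⟩ := Reach.exists_wordDist hT (f g) (f g')
    have := (Reach.of_correspondence (R := fun h g => R g h) htot' hR' hreach
      (hf g) (hf g')).wordDist_le
    rw [hk, sub_le_iff_le_add, div_le_iff₀ (by positivity)]
    push_cast at this
    have hB : (0 : ℝ) ≤ B := by positivity
    have hk0 : (0 : ℝ) ≤ k := by positivity
    nlinarith [mul_nonneg hB hB, mul_nonneg hB hk0]
  · obtain ⟨k, hk, hreach⟩ := Reach.exists_wordDist hS g g'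
    have := (Reach.of_correspondence (fun g => ⟨f g, hf g⟩) hR hreach
      (hf g) (hf g')).wordDist_le
    rw [hk]
    push_cast at this
    have hk0 : (0 : ℝ) ≤ k := by positivity
    nlinarith
  · intro h
    obtain ⟨g, hg⟩ := htot' h
    have := (hR g g h (f g) (Or.inl rfl) hg (hf g)).wordDist_le
    exact ⟨g, by linarith⟩

/-! ### Trees with a height function -/

/-- Two rooted trees, in which every vertex has `d + 1` children, whose roots are joined by an
edge. -/
inductive TwoTree (d : ℕ) : Type
  | base (b : Bool) : TwoTree d
  | child (v : TwoTree d) (c : Fin (d + 1)) : TwoTree d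

namespace TwoTree

/-- Adjacency in the tree. -/
def Adj {d : ℕ} (u w : TwoTree d) : Prop :=
  (∃ c, w = child u c) ∨ (∃ c, u = child w c) ∨ ∃ b, u = base b ∧ w = base (!b)

theorem Adj.symm {d : ℕ} {u w : TwoTree d} (H : Adj u w) : Adj w u := by
  rcases H with H | H | ⟨b, hu, hw⟩
  · exact Or.inr (Or.inl H)
  · exact Or.inl H
  · exact Or.inr (Or.inr ⟨!b, hw, by simpa using hu⟩)

/-- `Near k u w`: the vertices `u` and `w` are at distance at most `k` in the tree. -/
inductive Near {d : ℕ} : ℕ → TwoTree d → TwoTree d → Prop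
  | refl (k : ℕ) (v : TwoTree d) : Near k v v
  | step {k : ℕ} {u v w : TwoTree d} (H : Near k u v) (h : Adj v w) : Near (k + 1) u w

namespace Near

variable {d : ℕ} {u v w : TwoTree d} {k l : ℕ}

theorem mono (H : Near k u v) (hkl : k ≤ l) : Near l u v := by
  induction H generalizing l with
  | refl k v => exact refl l v
  | step H h ih =>
    obtain ⟨l, rfl⟩ : ∃ l', l = l' + 1 := ⟨l - 1, by omega⟩
    exact step (ih (by omega)) h

theorem trans (H : Near k u v) (H' : Near l v w) : Near (k + l) u w := by
  induction H' with
  | refl l v => exact H.mono (by omega)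
  | step _ h ih => exact step (ih H) h

theorem symm (H : Near k u v) : Near k v u := by
  induction H with
  | refl k v => exact refl k v
  | step _ h ih => exact ((step (refl 0 _) h.symm).trans ih).mono (by omega)

end Near

section Spine

set_option linter.unusedSectionVars false

variable {d d' : ℕ} [NeZero d] [NeZero d']

/-- The path starting at `v` whose next vertex is chosen by `nx`, a rule that depends on `v` and
on a vertex `v'` of another tree. -/
def spine (nx : TwoTree d → TwoTree d' → TwoTree d → Fin (d + 1)) (v : TwoTree d)
    (v' : TwoTree d') : ℕ → TwoTree d
  | 0 => v
  | k + 1 => child (spine nx v v' k) (nx v v' (spine nx v v' k))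

/-- The enumeration, by `q ≤ s * d`, of the children of the first `s` vertices of a spine that are
not among these `s` vertices. -/
def exit (nx : TwoTree d → TwoTree d' → TwoTree d → Fin (d + 1)) (s : ℕ) (v : TwoTree d)
    (v' : TwoTree d') (q : ℕ) : TwoTree d :=
  if q < s * d then
    child (spine nx v v' (q / d)) ((nx v v' (spine nx v v' (q / d))).succAbove (Fin.ofNat d q))
  else spine nx v v' s

/-- The decomposition of the tree into spines of length `s`. The value `(v, v', k)` at `u` means
that `u` is the `k`-th vertex of the spine starting at `v`, and that this spine is matched with the
spine of the other tree starting at `v'`; the exits of matched spines are matched in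
reverse order. -/
def state (nx : TwoTree d → TwoTree d' → TwoTree d → Fin (d + 1))
    (nx' : TwoTree d' → TwoTree d → TwoTree d' → Fin (d' + 1)) (s s' : ℕ) :
    TwoTree d → TwoTree d × TwoTree d' × ℕ
  | base b => (base b, base b, 0)
  | child u c =>
    match finSuccEquiv' (nx (state nx nx' s s' u).1 (state nx nx' s s' u).2.1 u) c with
    | none =>
      if (state nx nx' s s' u).2.2 + 1 < s then
        ((state nx nx' s s' u).1, (state nx nx' s s' u).2.1, (state nx nx' s s' u).2.2 + 1)
      else (child u c, exit nx' s' (state nx nx' s s' u).2.1 (state nx nx' s s' u).1 0, 0)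
    | some i =>
      (child u c, exit nx' s' (state nx nx' s s' u).2.1 (state nx nx' s s' u).1
        (s * d - ((state nx nx' s s' u).2.2 * d + i)), 0)

variable {nx : TwoTree d → TwoTree d' → TwoTree d → Fin (d + 1)}
  {nx' : TwoTree d' → TwoTree d → TwoTree d' → Fin (d' + 1)} {s s' : ℕ}
  {v u : TwoTree d} {v' : TwoTree d'} {k : ℕ}

theorem exit_add (hk : k < s) (i : Fin d) :
    exit nx s v v' (k * d + i) =
      child (spine nx v v' k) ((nx v v' (spine nx v v' k)).succAbove i) := by
  have hd : 0 < d := Nat.pos_of_neZero d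
  have hlt : k * d + i < s * d := by
    calc k * d + i < k * d + d := by omega
      _ = (k + 1) * d := by ring
      _ ≤ s * d := Nat.mul_le_mul_right d hk
  have hdiv : (k * d + i) / d = k := by
    rw [mul_comm, Nat.mul_add_div hd, Nat.div_eq_of_lt i.2, add_zero]
  have hmod : Fin.ofNat d (k * d + i) = i := by
    ext
    simp [Fin.ofNat, Nat.mod_eq_of_lt i.2]
  rw [exit, if_pos hlt, hdiv, hmod]

theorem exit_last : exit nx s v v' (s * d) = spine nx v v' s := by
  simp [exit]

theorem exit_cases {q : ℕ} (hq : q ≤ s * d) :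
    (∃ k < s, ∃ i : Fin d, q = k * d + i) ∨ q = s * d := by
  have hd : 0 < d := Nat.pos_of_neZero d
  rcases hq.lt_or_eq with h | h
  · exact Or.inl ⟨q / d, (Nat.div_lt_iff_lt_mul hd).2 h, ⟨q % d, Nat.mod_lt q hd⟩,
      (Nat.div_add_mod' q d).symm⟩
  · exact Or.inr h

theorem state_child_next (hu : state nx nx' s s' u = (v, v', k)) :
    state nx nx' s s' (child u (nx v v' u)) =
      if k + 1 < s then (v, v', k + 1) else (child u (nx v v' u), exit nx' s' v' v 0, 0) := by
  rw [state, hu]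
  simp

theorem state_child_succAbove (hu : state nx nx' s s' u = (v, v', k)) (i : Fin d) :
    state nx nx' s s' (child u ((nx v v' u).succAbove i)) =
      (child u ((nx v v' u).succAbove i), exit nx' s' v' v (s * d - (k * d + i)), 0) := by
  rw [state, hu]
  simp

theorem state_spine (h : state nx nx' s s' v = (v, v', 0)) (hk : k < s) :
    state nx nx' s s' (spine nx v v' k) = (v, v', k) := by
  induction k with
  | zero => exact h
  | succ k ih => rw [spine, state_child_next (ih (by omega)), if_pos hk]

theorem state_exit (hs : 0 < s) (h : state nx nx' s s' v = (v, v', 0)) {q : ℕ} (hq : q ≤ s * d) :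
    state nx nx' s s' (exit nx s v v' q) =
      (exit nx s v v' q, exit nx' s' v' v (s * d - q), 0) := by
  rcases exit_cases hq with ⟨k, hk, i, rfl⟩ | rfl
  · rw [exit_add hk, state_child_succAbove (state_spine h hk)]
  · obtain ⟨r, rfl⟩ : ∃ r, s = r + 1 := ⟨s - 1, by omega⟩
    rw [exit_last, spine, state_child_next (state_spine h (Nat.lt_succ_self r)),
      if_neg (lt_irrefl _), Nat.sub_self]

/-- The vertices `v` and `v'` start matched spines. -/
def Matched (nx : TwoTree d → TwoTree d' → TwoTree d → Fin (d + 1))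
    (nx' : TwoTree d' → TwoTree d → TwoTree d' → Fin (d' + 1)) (s s' : ℕ)
    (v : TwoTree d) (v' : TwoTree d') : Prop :=
  state nx nx' s s' v = (v, v', 0) ∧ state nx' nx s' s v' = (v', v, 0)

theorem Matched.exit (hs : 0 < s) (hs' : 0 < s') (hd : s * d = s' * d')
    (h : Matched nx nx' s s' v v') {q : ℕ} (hq : q ≤ s * d) :
    Matched nx nx' s s' (exit nx s v v' q) (exit nx' s' v' v (s * d - q)) := by
  refine ⟨state_exit hs h.1 hq, ?_⟩
  rw [state_exit hs' h.2 (by omega), ← hd, Nat.sub_sub_self hq]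

/-- One step down in the tree either stays in the spine or leaves it through an exit. -/
theorem child_cases (hs : 0 < s) (h : state nx nx' s s' v = (v, v', 0)) (hk : k < s)
    (c : Fin (d + 1)) :
    (child (spine nx v v' k) c = spine nx v v' (k + 1) ∧ k + 1 < s) ∨
      ∃ q ≤ s * d, child (spine nx v v' k) c = exit nx s v v' q := by
  by_cases hc : c = nx v v' (spine nx v v' k)
  · subst hc
    by_cases hks : k + 1 < s
    · exact Or.inl ⟨rfl, hks⟩
    · obtain rfl : s = k + 1 := by omega
      exact Or.inr ⟨_, le_rfl, (exit_last (s := k + 1)).symm⟩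
  · obtain ⟨i, rfl⟩ := Fin.exists_succAbove_eq hc
    refine Or.inr ⟨k * d + i, ?_, (exit_add hk i).symm⟩
    calc k * d + i ≤ k * d + d := by omega
      _ = (k + 1) * d := by ring
      _ ≤ s * d := Nat.mul_le_mul_right d hk

/-- Every vertex lies on a matched spine. -/
theorem exists_state (hs : 0 < s) (hs' : 0 < s') (hd : s * d = s' * d')
    (P : TwoTree d → TwoTree d' → Prop) (hP₀ : ∀ b, P (base b) (base b))
    (hP : ∀ v v' q, P v v' → q ≤ s * d → P (exit nx s v v' q) (exit nx' s' v' v (s * d - q)))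
    (u : TwoTree d) :
    ∃ v v' k, k < s ∧ u = spine nx v v' k ∧ Matched nx nx' s s' v v' ∧ P v v' := by
  induction u with
  | base b => exact ⟨base b, base b, 0, hs, rfl, ⟨rfl, rfl⟩, hP₀ b⟩
  | child u c ih =>
    obtain ⟨v, v', k, hk, rfl, hm, hv⟩ := ih
    rcases child_cases hs hm.1 hk c with ⟨h, hk'⟩ | ⟨q, hq, h⟩
    · exact ⟨v, v', k + 1, hk', h, hm, hv⟩
    · exact ⟨_, _, 0, hs, h, hm.exit hs hs' hd hq, hP _ _ _ hv hq⟩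

theorem near_spine (hk : k ≤ s) : Near s v (spine nx v v' k) := by
  refine Near.mono ?_ hk
  clear hk
  induction k with
  | zero => exact Near.refl _ _
  | succ k ih => exact ih.step (Or.inl ⟨_, rfl⟩)

theorem near_exit {q : ℕ} (hq : q ≤ s * d) :
    Near (s + 1) v (exit nx s v v' q) := by
  rcases exit_cases hq with ⟨k, hk, i, rfl⟩ | rfl
  · rw [exit_add hk]
    exact (near_spine hk.le).step (Or.inl ⟨_, rfl⟩)
  · rw [exit_last]
    exact (near_spine le_rfl).mono (by omega)

/-- Two vertices correspond when they lie on matched spines. -/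
def Corr (nx : TwoTree d → TwoTree d' → TwoTree d → Fin (d + 1))
    (nx' : TwoTree d' → TwoTree d → TwoTree d' → Fin (d' + 1)) (s s' : ℕ)
    (u : TwoTree d) (u' : TwoTree d') : Prop :=
  ∃ v v' k k', k < s ∧ k' < s' ∧ u = spine nx v v' k ∧ u' = spine nx' v' v k' ∧
    Matched nx nx' s s' v v'

theorem Corr.symm {u' : TwoTree d'} (h : Corr nx nx' s s' u u') : Corr nx' nx s' s u' u := by
  obtain ⟨v, v', k, k', hk, hk', hu, hu', hm⟩ := h
  exact ⟨v', v, k', k, hk', hk, hu', hu, hm.2, hm.1⟩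

theorem Corr.near_of_eq {u' w' : TwoTree d'} (h : Corr nx nx' s s' u u')
    (h' : Corr nx nx' s s' u w') : Near (s' + s') u' w' := by
  obtain ⟨v, v', k, k', hk, hk', hu, rfl, hm⟩ := h
  obtain ⟨x, x', l, l', hl, hl', hu₂, rfl, hm₂⟩ := h'
  have h₁ := state_spine hm.1 hk
  have h₂ := state_spine hm₂.1 hl
  rw [← hu] at h₁
  rw [← hu₂, h₁] at h₂
  simp only [Prod.mk.injEq] at h₂
  obtain ⟨rfl, rfl, rfl⟩ := h₂
  exact (near_spine hk'.le).symm.trans (near_spine hl'.le)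

theorem Corr.near_of_child (hs : 0 < s) (hs' : 0 < s') (hd : s * d = s' * d')
    {c : Fin (d + 1)} {u' w' : TwoTree d'} (h : Corr nx nx' s s' u u')
    (h' : Corr nx nx' s s' (child u c) w') : Near (4 * s' + 1) u' w' := by
  obtain ⟨v, v', k, k', hk, hk', rfl, rfl, hm⟩ := h
  rcases child_cases hs hm.1 hk c with ⟨h, hkk⟩ | ⟨q, hq, h⟩
  · have : Corr nx nx' s s' (child (spine nx v v' k) c) (spine nx' v' v k') :=
      ⟨v, v', k + 1, k', hkk, hk', h, rfl, hm⟩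
    exact (this.near_of_eq h').mono (by omega)
  · have : Corr nx nx' s s' (child (spine nx v v' k) c) (exit nx' s' v' v (s * d - q)) :=
      ⟨_, _, 0, 0, hs, hs', h, rfl, hm.exit hs hs' hd hq⟩
    exact (((near_spine hk'.le).symm.trans (near_exit (by omega))).trans
      (this.near_of_eq h')).mono (by omega)

theorem Corr.near_of_adj (hs : 0 < s) (hs' : 0 < s') (hd : s * d = s' * d')
    {w : TwoTree d} {u' w' : TwoTree d'} (huw : w = u ∨ Adj u w) (h : Corr nx nx' s s' u u')
    (h' : Corr nx nx' s s' w w') : Near (4 * s' + 1) u' w' := by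
  rcases huw with rfl | ⟨c, rfl⟩ | ⟨c, rfl⟩ | ⟨b, rfl, rfl⟩
  · exact (h.near_of_eq h').mono (by omega)
  · exact h.near_of_child hs hs' hd h'
  · exact (h'.near_of_child hs hs' hd h).symm
  · have hb : ∀ b, Corr nx nx' s s' (base b) (base b) := fun b =>
      ⟨base b, base b, 0, 0, hs, hs', rfl, rfl, rfl, rfl⟩
    exact (((h.near_of_eq (hb b)).step (Or.inr (Or.inr ⟨b, rfl, rfl⟩))).trans
      ((hb _).near_of_eq h')).mono (by omega)

end Spine

/-- A height function on the tree: it changes by at most `a` along edges, and from every vertex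
one can go down the tree while increasing, or decreasing, the height by `a`. -/
structure IsHeight {d : ℕ} (h : TwoTree d → ℝ) (a : ℝ) : Prop where
  pos : 0 < a
  base_le : ∀ b, |h (base b)| ≤ a
  child_le : ∀ v c, |h (child v c) - h v| ≤ a
  exists_up : ∀ v, ∃ c, h (child v c) = h v + a
  exists_down : ∀ v, ∃ c, h (child v c) = h v - a

section Height

set_option linter.unusedSectionVars false

variable {d d' : ℕ} [NeZero d] [NeZero d'] {h : TwoTree d → ℝ} {a : ℝ}

theorem IsHeight.exists_toward (H : IsHeight h a) (M : ℝ) (v : TwoTree d) :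
    ∃ c, |h (child v c) - M| ≤ max (|h v - M| - a) a := by
  have := H.pos
  rcases le_total (h v) M with hv | hv
  · obtain ⟨c, hc⟩ := H.exists_up v
    refine ⟨c, ?_⟩
    rw [hc, abs_of_nonpos (a := h v - M) (by linarith), le_max_iff, abs_le, abs_le]
    by_contra! hcon
    by_cases h1 : h v + a ≤ M
    · linarith [hcon.1 (by linarith)]
    · linarith [hcon.2 (by linarith)]
  · obtain ⟨c, hc⟩ := H.exists_down v
    refine ⟨c, ?_⟩
    rw [hc, abs_of_nonneg (a := h v - M) (by linarith), le_max_iff, abs_le, abs_le]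
    by_contra! hcon
    by_cases h1 : h v - a ≤ M
    · linarith [hcon.2 (by linarith)]
    · linarith [hcon.1 (by linarith)]

variable {nx : TwoTree d → TwoTree d' → TwoTree d → Fin (d + 1)} {M E : ℝ}
  {v : TwoTree d} {v' : TwoTree d'}

theorem IsHeight.spine_le (H : IsHeight h a)
    (hnx : ∀ u, |h (child u (nx v v' u)) - M| ≤ max (|h u - M| - a) a) (hv : |h v - M| ≤ E)
    (k : ℕ) : |h (spine nx v v' k) - M| ≤ max (E - k * a) a := by
  have := H.pos
  induction k with
  | zero => exact le_max_of_le_left (by simpa [spine] using hv)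
  | succ k ih =>
    refine (hnx _).trans (max_le ?_ (le_max_right _ _))
    rcases le_max_iff.1 ih with h1 | h1
    · exact le_max_of_le_left (by push_cast; linarith)
    · exact le_max_of_le_right (by linarith)

theorem IsHeight.exit_le (H : IsHeight h a) {s : ℕ}
    (hnx : ∀ u, |h (child u (nx v v' u)) - M| ≤ max (|h u - M| - a) a) (hv : |h v - M| ≤ E)
    (haE : a ≤ E) {q : ℕ} (hq : q ≤ s * d) :
    |h (exit nx s v v' q) - M| ≤ E + a ∧
      ∀ t ≤ s, E ≤ t * a → t * d ≤ q → |h (exit nx s v v' q) - M| ≤ 2 * a := by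
  have ha := H.pos
  have hsp := H.spine_le hnx hv
  have hE : ∀ k, |h (spine nx v v' k) - M| ≤ E := fun k =>
    (hsp k).trans (max_le (by nlinarith [(Nat.cast_nonneg k : (0 : ℝ) ≤ k)]) haE)
  have hE' : ∀ t k : ℕ, E ≤ t * a → t ≤ k → |h (spine nx v v' k) - M| ≤ a := fun t k ht hk => by
    refine (hsp k).trans (max_le ?_ le_rfl)
    have : (t : ℝ) ≤ k := by exact_mod_cast hk
    nlinarith
  rcases exit_cases hq with ⟨k, hk, i, rfl⟩ | rfl
  · rw [exit_add hk]
    have hc := H.child_le (spine nx v v' k) ((nx v v' (spine nx v v' k)).succAbove i)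
    have key := abs_sub_le (h (child (spine nx v v' k) ((nx v v' (spine nx v v' k)).succAbove i)))
      (h (spine nx v v' k)) M
    refine ⟨by linarith [hE k], fun t _ ht htq => ?_⟩
    have hd : 0 < d := Nat.pos_of_neZero d
    have htk : t ≤ k := by
      by_contra! hcon
      have h1 : (k + 1) * d ≤ t * d := Nat.mul_le_mul_right d hcon
      have h2 := i.2
      rw [add_mul] at h1
      omega
    linarith [hE' t k ht htk]
  · rw [exit_last]
    exact ⟨by linarith [hE s], fun t hts ht _ => by linarith [hE' t s ht hts]⟩

/-- Any two of these trees with height functions correspond coarsely. -/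
theorem IsHeight.exists_corr {h' : TwoTree d' → ℝ} {b : ℝ} (H : IsHeight h a)
    (H' : IsHeight h' b) :
    ∃ (R : TwoTree d → TwoTree d' → Prop) (K : ℕ) (C : ℝ),
      (∀ u, ∃ u', R u u') ∧ (∀ u', ∃ u, R u u') ∧ (∀ u u', R u u' → |h u - h' u'| ≤ C) ∧
      (∀ u w u' w', (w = u ∨ Adj u w) → R u u' → R w w' → Near K u' w') ∧
      (∀ u w u' w', (w' = u' ∨ Adj u' w') → R u u' → R w w' → Near K u w) := by
  have ha := H.pos
  have hb := H'.pos
  choose f hf using H.exists_toward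
  choose f' hf' using H'.exists_toward
  let M : TwoTree d → TwoTree d' → ℝ := fun v v' => (h v + h' v') / 2
  let nx : TwoTree d → TwoTree d' → TwoTree d → Fin (d + 1) := fun v v' u => f (M v v') u
  let nx' : TwoTree d' → TwoTree d → TwoTree d' → Fin (d' + 1) := fun v' v u' => f' (M v v') u'
  obtain ⟨t₁, ht₁⟩ := exists_nat_ge (2 * (a + b) / a)
  obtain ⟨t₂, ht₂⟩ := exists_nat_ge (2 * (a + b) / b)
  rw [div_le_iff₀ ha] at ht₁
  rw [div_le_iff₀ hb] at ht₂
  obtain ⟨t, ht0, hta, htb⟩ : ∃ t : ℕ, 0 < t ∧ 2 * (a + b) ≤ t * a ∧ 2 * (a + b) ≤ t * b := by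
    refine ⟨t₁ + t₂ + 1, by omega, ?_, ?_⟩ <;> push_cast <;>
      nlinarith [(Nat.cast_nonneg t₁ : (0 : ℝ) ≤ t₁), (Nat.cast_nonneg t₂ : (0 : ℝ) ≤ t₂)]
  have hd : 0 < d := Nat.pos_of_neZero d
  have hd' : 0 < d' := Nat.pos_of_neZero d'
  obtain ⟨s, hsdef⟩ : ∃ s, s = d' * (2 * t) := ⟨_, rfl⟩
  obtain ⟨s', hsdef'⟩ : ∃ s', s' = d * (2 * t) := ⟨_, rfl⟩
  have hts : t ≤ s := by rw [hsdef]; nlinarith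
  have hts' : t ≤ s' := by rw [hsdef']; nlinarith
  have hsd : s * d = s' * d' := by rw [hsdef, hsdef']; ring
  have hbig : t * d + t * d' ≤ s * d := by
    have h1 : t * d ≤ t * d * d' := Nat.le_mul_of_pos_right _ hd'
    have h2 : t * d' ≤ t * d' * d := Nat.le_mul_of_pos_right _ hd
    calc t * d + t * d' ≤ t * d * d' + t * d' * d := by omega
      _ = s * d := by rw [hsdef]; ring
  have hs : 0 < s := by omega
  have hs' : 0 < s' := by omega
  have hmid : ∀ v v', |h v - h' v'| ≤ 4 * (a + b) →
      |h v - M v v'| ≤ 2 * (a + b) ∧ |h' v' - M v v'| ≤ 2 * (a + b) := fun v v' hv => by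
    rw [abs_le] at hv
    simp only [M, abs_le]
    refine ⟨⟨?_, ?_⟩, ?_, ?_⟩ <;> linarith [hv.1, hv.2]
  have hP₀ : ∀ c, |h (base c) - h' (base c)| ≤ 4 * (a + b) := fun c => by
    have h1 := H.base_le c
    have h2 := H'.base_le c
    rw [abs_le] at *
    constructor <;> linarith
  have hP : ∀ v v' q, |h v - h' v'| ≤ 4 * (a + b) → q ≤ s * d →
      |h (exit nx s v v' q) - h' (exit nx' s' v' v (s * d - q))| ≤ 4 * (a + b) := by
    intro v v' q hv hq
    obtain ⟨h1, h2⟩ := hmid v v' hv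
    obtain ⟨hA, hA'⟩ := H.exit_le (nx := nx) (fun u => hf _ u) h1 (by linarith) hq
    obtain ⟨hB, hB'⟩ := H'.exit_le (nx := nx') (s := s') (q := s * d - q) (fun u => hf' _ u) h2
      (by linarith) (by omega)
    have key := abs_sub_le (h (exit nx s v v' q)) (M v v') (h' (exit nx' s' v' v (s * d - q)))
    rw [abs_sub_comm (M v v')] at key
    by_cases htq : t * d ≤ q
    · linarith [hA' t hts hta htq]
    · linarith [hB' t hts' htb (by omega)]
  have hst := exists_state (nx := nx) (nx' := nx') hs hs' hsd
    (fun v v' => |h v - h' v'| ≤ 4 * (a + b)) hP₀ hP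
  have hst' := exists_state (nx := nx') (nx' := nx) hs' hs hsd.symm
    (fun v' v => |h v - h' v'| ≤ 4 * (a + b)) hP₀ (fun v' v q hv hq => by
      have := hP v v' (s' * d' - q) hv (by omega)
      rwa [hsd, Nat.sub_sub_self hq] at this)
  refine ⟨fun u u' => Corr nx nx' s s' u u', 4 * s' + 1 + (4 * s + 1), 8 * (a + b),
    fun u => ?_, fun u' => ?_, fun u u' hu => ?_, fun u w u' w' hw hu hu' => ?_,
    fun u w u' w' hw hu hu' => ?_⟩
  · obtain ⟨v, v', k, hk, hu, hm, -⟩ := hst u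
    exact ⟨v', v, v', k, 0, hk, hs', hu, rfl, hm⟩
  · obtain ⟨v', v, k, hk, hu, hm, -⟩ := hst' u'
    exact ⟨v, v, v', 0, k, hs, hk, rfl, hu, hm.2, hm.1⟩
  · obtain ⟨x, x', l, hl, hux, hmx, hPx⟩ := hst u
    obtain ⟨v, v', k, k', hk, hk', rfl, rfl, hm⟩ := hu
    have e₁ := state_spine hm.1 hk
    have e₂ := state_spine hmx.1 hl
    rw [← hux, e₁] at e₂
    simp only [Prod.mk.injEq] at e₂
    obtain ⟨rfl, rfl, rfl⟩ := e₂
    obtain ⟨h1, h2⟩ := hmid v v' hPx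
    have hA := H.spine_le (nx := nx) (v' := v') (fun u => hf _ u) h1 k
    have hB := H'.spine_le (nx := nx') (v' := v) (fun u => hf' _ u) h2 k'
    have hA' := hA.trans (max_le (c := 2 * (a + b))
      (by nlinarith [(Nat.cast_nonneg k : (0 : ℝ) ≤ k)]) (by linarith))
    have hB' := hB.trans (max_le (c := 2 * (a + b))
      (by nlinarith [(Nat.cast_nonneg k' : (0 : ℝ) ≤ k')]) (by linarith))
    have key := abs_sub_le (h (spine nx v v' k)) (M v v') (h' (spine nx' v' v k'))
    rw [abs_sub_comm (M v v')] at key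
    linarith
  · exact (hu.near_of_adj hs hs' hsd hw hu').mono (by omega)
  · exact (hu.symm.near_of_adj hs' hs hsd.symm hw hu'.symm).mono (by omega)

end Height

end TwoTree

/-! ### Baumslag–Solitar groups as trees times `ℤ` -/

/-- The edges leaving a vertex of the Bass–Serre tree are pairs of a sign `b` and an integer
in `[0, N b)`. At a vertex whose edge from its parent has sign `e`, the edge `(!e, 0)` leads back
to the parent; the others are numbered by `Fin (d + 1)`. -/
structure EdgeCoding (N : Bool → ℤ) (d : ℕ) where
  sgn : Bool → Fin (d + 1) → Bool
  ind : Bool → Fin (d + 1) → ℤ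
  enc : Bool → Bool → ℤ → Fin (d + 1)
  ind_nonneg : ∀ e c, 0 ≤ ind e c
  ind_lt : ∀ e c, ind e c < N (sgn e c)
  not_back : ∀ e c, ¬(sgn e c = !e ∧ ind e c = 0)
  sgn_enc : ∀ e b i, 0 ≤ i → i < N b → ¬(b = !e ∧ i = 0) → sgn e (enc e b i) = b
  ind_enc : ∀ e b i, 0 ≤ i → i < N b → ¬(b = !e ∧ i = 0) → ind e (enc e b i) = i
  enc_sgn : ∀ e c, enc e (sgn e c) (ind e c) = c

theorem EdgeCoding.exists_of_card {N : Bool → ℤ} (hN : ∀ b, 0 < N b) {d : ℕ}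
    (hd : (d : ℤ) + 2 = N true + N false) : Nonempty (EdgeCoding N d) := by
  let L : Bool → Finset (Σ _ : Bool, ℤ) := fun e =>
    ((Finset.univ : Finset Bool).sigma fun b => Finset.Ico 0 (N b)).erase ⟨!e, 0⟩
  have hmem : ∀ e b i, (⟨b, i⟩ : Σ _ : Bool, ℤ) ∈ L e ↔ 0 ≤ i ∧ i < N b ∧ ¬(b = !e ∧ i = 0) := by
    intro e b i
    simp only [L, Finset.mem_erase, Finset.mem_sigma, Finset.mem_univ, true_and, Finset.mem_Ico,
      ne_eq, Sigma.mk.injEq, heq_eq_eq]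
    tauto
  have hcard : ∀ e, (L e).card = d + 1 := by
    intro e
    have h0 : (⟨!e, 0⟩ : Σ _ : Bool, ℤ) ∈
        (Finset.univ : Finset Bool).sigma fun b => Finset.Ico 0 (N b) := by simp [hN]
    simp only [L, Finset.card_erase_of_mem h0, Finset.card_sigma, Fintype.sum_bool, Int.card_Ico]
    have := hN true
    have := hN false
    omega
  let E : ∀ e, L e ≃ Fin (d + 1) := fun e => Finset.equivFinOfCardEq (hcard e)
  have hE : ∀ e c, 0 ≤ ((E e).symm c).1.2 ∧ ((E e).symm c).1.2 < N ((E e).symm c).1.1 ∧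
      ¬(((E e).symm c).1.1 = !e ∧ ((E e).symm c).1.2 = 0) := fun e c =>
    (hmem e _ _).1 ((E e).symm c).2
  exact ⟨{
    sgn := fun e c => ((E e).symm c).1.1
    ind := fun e c => ((E e).symm c).1.2
    enc := fun e b i => if h : (⟨b, i⟩ : Σ _ : Bool, ℤ) ∈ L e then E e ⟨_, h⟩ else 0
    ind_nonneg := fun e c => (hE e c).1
    ind_lt := fun e c => (hE e c).2.1
    not_back := fun e c => (hE e c).2.2
    sgn_enc := fun e b i h0 h1 h2 => by
      rw [dif_pos ((hmem e b i).2 ⟨h0, h1, h2⟩), Equiv.symm_apply_apply]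
    ind_enc := fun e b i h0 h1 h2 => by
      rw [dif_pos ((hmem e b i).2 ⟨h0, h1, h2⟩), Equiv.symm_apply_apply]
    enc_sgn := fun e c => by
      rw [dif_pos ((E e).symm c).2]
      exact (E e).apply_symm_apply c }⟩

namespace EdgeCoding

open TwoTree

variable {N : Bool → ℤ} {d : ℕ} (D : EdgeCoding N d)

/-- The sign of the edge from the parent. -/
def last : TwoTree d → Bool
  | base b => b
  | child v c => D.sgn (last v) c

/-- The integer labelling the edge from the parent. -/
def idx : TwoTree d → ℤ
  | base _ => 0
  | child v c => D.ind (D.last v) c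

/-- The parent of a vertex; the two roots are parents of each other. -/
def par : TwoTree d → TwoTree d
  | base b => base !b
  | child v _ => v

/-- Right multiplication by the stable letter (for `e = true`) or its inverse, in terms of normal
forms. -/
def step (e : Bool) (s : TwoTree d × ℤ) : TwoTree d × ℤ :=
  if D.last s.1 = (!e) ∧ s.2 % N e = 0 then
    (par s.1, D.idx s.1 + N (!e) * (s.2 / N e))
  else (child s.1 (D.enc (D.last s.1) e (s.2 % N e)), N (!e) * (s.2 / N e))

theorem idx_nonneg (v : TwoTree d) : 0 ≤ D.idx v := by
  cases v with
  | base b => exact le_rfl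
  | child v c => exact D.ind_nonneg _ _

variable (hN : ∀ b, 0 < N b)
include hN

theorem idx_lt (v : TwoTree d) : D.idx v < N (D.last v) := by
  cases v with
  | base b => exact hN _
  | child v c => exact D.ind_lt _ _

theorem step_par (v : TwoTree d) (j : ℤ) :
    D.step (D.last v) (par v, D.idx v + N (D.last v) * j) = (v, N (!D.last v) * j) := by
  have h0 := (hN (D.last v)).ne'
  have hmod : (D.idx v + N (D.last v) * j) % N (D.last v) = D.idx v := by
    rw [Int.add_mul_emod_self_left, Int.emod_eq_of_lt (D.idx_nonneg v) (D.idx_lt hN v)]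
  have hdiv : (D.idx v + N (D.last v) * j) / N (D.last v) = j := by
    rw [Int.add_mul_ediv_left _ _ h0,
      Int.ediv_eq_zero_of_lt (D.idx_nonneg v) (D.idx_lt hN v), zero_add]
  simp only [step, hmod, hdiv]
  cases v with
  | base b => simp [par, last, idx]
  | child v c =>
    rw [if_neg]
    · simp only [par, last, idx, D.enc_sgn]
    · rintro ⟨h1, h2⟩
      exact D.not_back (D.last v) c ⟨by simpa [par, last] using congrArg Bool.not h1.symm, h2⟩

theorem step_cases (e : Bool) (s : TwoTree d × ℤ) :
    (e = !D.last s.1 ∧ s.2 = N e * (s.2 / N e) ∧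
      D.step e s = (par s.1, D.idx s.1 + N (!e) * (s.2 / N e))) ∨
    ∃ c, D.last (child s.1 c) = e ∧ s.2 = D.idx (child s.1 c) + N e * (s.2 / N e) ∧
      D.step e s = (child s.1 c, N (!e) * (s.2 / N e)) := by
  have hdm := Int.emod_add_mul_ediv s.2 (N e)
  by_cases h : D.last s.1 = (!e) ∧ s.2 % N e = 0
  · refine Or.inl ⟨by simp [h.1], ?_, by rw [step, if_pos h]⟩
    rw [h.2] at hdm
    linarith
  · have h0 := Int.emod_nonneg s.2 (hN e).ne'
    have h1 := Int.emod_lt_of_pos s.2 (hN e)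
    have h2 : ¬(e = (!D.last s.1) ∧ s.2 % N e = 0) := fun hc => h ⟨by simp [hc.1], hc.2⟩
    refine Or.inr ⟨_, D.sgn_enc _ _ _ h0 h1 h2, ?_, by rw [step, if_neg h]⟩
    rw [idx, D.ind_enc _ _ _ h0 h1 h2]
    exact hdm.symm

theorem step_step (e : Bool) (s : TwoTree d × ℤ) : D.step (!e) (D.step e s) = s := by
  rcases D.step_cases hN e s with ⟨h1, h2, h3⟩ | ⟨c, h1, h2, h3⟩
  · have := D.step_par hN s.1 (s.2 / N e)
    rw [h3]
    subst h1
    simp only [Bool.not_not] at this ⊢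
    rw [this, ← h2]
  · subst h1
    rw [h3, step, if_pos]
    · refine Prod.ext rfl ?_
      simp only [Bool.not_not, Int.mul_ediv_cancel_left _ (hN _).ne']
      exact h2.symm
    · simp

/-- The permutation `step true`. -/
def stepPerm : Equiv.Perm (TwoTree d × ℤ) where
  toFun := D.step true
  invFun := D.step false
  left_inv := D.step_step hN true
  right_inv := D.step_step hN false

omit hN in
theorem step_fst (e : Bool) (v : TwoTree d) {i j : ℤ} (h : i % N e = j % N e) :
    (D.step e (v, i)).1 = (D.step e (v, j)).1 := by
  simp only [step, h]
  split_ifs <;> rfl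

theorem step_add (e : Bool) (v : TwoTree d) (j k : ℤ) :
    D.step e (v, j + N e * k) =
      ((D.step e (v, j)).1, (D.step e (v, j)).2 + N (!e) * k) := by
  have h0 := (hN e).ne'
  simp only [step, Int.add_mul_emod_self_left, Int.add_mul_ediv_left _ _ h0]
  split_ifs <;> simp only [Prod.mk.injEq, true_and] <;> ring

theorem adj_step (e : Bool) (s : TwoTree d × ℤ) : Adj s.1 (D.step e s).1 := by
  rcases D.step_cases hN e s with ⟨_, _, h3⟩ | ⟨c, _, _, h3⟩
  · rw [h3]
    obtain ⟨v, j⟩ := s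
    cases v with
    | base b => exact Or.inr (Or.inr ⟨b, rfl, rfl⟩)
    | child v c => exact Or.inr (Or.inl ⟨c, rfl⟩)
  · rw [h3]
    exact Or.inl ⟨c, rfl⟩

theorem exists_step_of_adj {u w : TwoTree d} (h : Adj u w) :
    ∃ e j, (D.step e (u, j)).1 = w := by
  have key : ∀ v : TwoTree d, (∃ e j, (D.step e (par v, j)).1 = v) ∧
      ∃ e j, (D.step e (v, j)).1 = par v := fun v =>
    ⟨⟨D.last v, _, congrArg Prod.fst (D.step_par hN v 0)⟩, !D.last v, 0, by simp [step]⟩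
  rcases h with ⟨c, rfl⟩ | ⟨c, rfl⟩ | ⟨b, rfl, rfl⟩
  · exact (key (child u c)).1
  · exact (key (child w c)).2
  · exact (key (base b)).2

omit hN

/-! #### Heights and positions -/

/-- The height of a vertex, which increases by `a` along positive edges. -/
def height (a : ℝ) : TwoTree d → ℝ
  | base b => if b then 0 else -a
  | child v c => height a v + if D.sgn (D.last v) c then a else -a

/-- The real coordinate of the reference point in the fibre over a vertex. -/
noncomputable def origin (a : ℝ) : TwoTree d → ℝ
  | base _ => 0
  | child v c => origin a v + Real.exp (D.height a v) * D.ind (D.last v) c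

/-- The real coordinate of a normal form. -/
noncomputable def coord (a : ℝ) (s : TwoTree d × ℤ) : ℝ :=
  D.origin a s.1 + Real.exp (D.height a s.1) * s.2

theorem height_par (a : ℝ) (v : TwoTree d) :
    D.height a v = D.height a (par v) + if D.last v then a else -a := by
  cases v with
  | base b => cases b <;> simp [height, par, last]
  | child v c => rfl

theorem origin_par (a : ℝ) (v : TwoTree d) :
    D.origin a v = D.origin a (par v) + Real.exp (D.height a (par v)) * D.idx v := by
  cases v with
  | base b => simp [origin, par, idx]
  | child v c => rfl

theorem isHeight {a : ℝ} (ha : 0 < a) (hN1 : ∀ b, 1 < N b) : IsHeight (D.height a) a where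
  pos := ha
  base_le b := by cases b <;> simp [height, abs_of_pos ha, ha.le]
  child_le v c := by
    simp only [height, add_sub_cancel_left]
    split_ifs <;> simp [abs_of_pos ha]
  exists_up v := ⟨D.enc (D.last v) true 1, by
    simp only [height, D.sgn_enc (D.last v) true 1 zero_le_one (hN1 _) (by simp), if_true]⟩
  exists_down v := ⟨D.enc (D.last v) false 1, by
    simp [height, D.sgn_enc (D.last v) false 1 zero_le_one (hN1 _) (by simp), sub_eq_add_neg]⟩

theorem height_adj {a : ℝ} (ha : 0 < a) {u w : TwoTree d} (h : Adj u w) :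
    |D.height a u - D.height a w| ≤ a := by
  have key : ∀ v, |D.height a v - D.height a (par v)| ≤ a := fun v => by
    rw [D.height_par a v, add_sub_cancel_left]
    split_ifs <;> simp [abs_of_pos ha]
  rcases h with ⟨c, rfl⟩ | ⟨c, rfl⟩ | ⟨b, rfl, rfl⟩
  · rw [abs_sub_comm]
    exact key (child u c)
  · exact key (child w c)
  · exact key (base b)

theorem height_near {a : ℝ} (ha : 0 < a) {k : ℕ} {u w : TwoTree d} (h : Near k u w) :
    |D.height a u - D.height a w| ≤ k * a := by
  induction h with
  | refl k v => simpa using mul_nonneg (Nat.cast_nonneg k) ha.le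
  | @step k u v w _ h ih =>
    have := abs_sub_le (D.height a u) (D.height a v) (D.height a w)
    have := D.height_adj ha h
    push_cast
    linarith

include hN in
theorem coord_step (e : Bool) (s : TwoTree d × ℤ) :
    D.coord (Real.log (N true / N false)) (D.step e s) =
      D.coord (Real.log (N true / N false)) s := by
  have ht : (0 : ℝ) < N true := by exact_mod_cast hN true
  have hf : (0 : ℝ) < N false := by exact_mod_cast hN false
  have hexp : ∀ b, Real.exp (if b then Real.log (N true / N false)
      else -Real.log (N true / N false)) * N (!b) = N b := by
    intro b
    cases b
    · simp only [Bool.false_eq_true, if_false, Real.exp_neg, Real.exp_log (div_pos ht hf),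
        Bool.not_false]
      field_simp
    · simp only [if_true, Real.exp_log (div_pos ht hf), Bool.not_true]
      field_simp
  have key : ∀ v j, D.coord (Real.log (N true / N false))
      (par v, D.idx v + N (D.last v) * j) =
      D.coord (Real.log (N true / N false)) (v, N (!D.last v) * j) := by
    intro v j
    have h := hexp (D.last v)
    simp only [coord]
    rw [D.origin_par _ v, D.height_par _ v, Real.exp_add]
    push_cast
    rw [← h]
    ring
  rcases D.step_cases hN e s with ⟨h1, h2, h3⟩ | ⟨c, h1, h2, h3⟩
  · rw [h3]
    subst h1
    have := key s.1 (s.2 / N (!D.last s.1))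
    rw [← h2] at this
    simpa using this
  · rw [h3]
    subst h1
    have := key (child s.1 c) (s.2 / N (D.last (child s.1 c)))
    rw [← h2] at this
    exact this.symm

end EdgeCoding

namespace BS

open TwoTree MulOpposite

/-- The bounds for the integer labels of the negative and positive edges. -/
def bound (m n : ℤ) (b : Bool) : ℤ := if b then n else m

/-- The stable letter (for `e = true`) or its inverse. -/
def letter (m n : ℤ) (e : Bool) : BS m n :=
  if e then PresentedGroup.of 0 else (PresentedGroup.of 0)⁻¹

/-- The generator of the vertex group. -/
def vert (m n : ℤ) : BS m n := PresentedGroup.of 1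

/-- The standard generators. -/
noncomputable def gens (m n : ℤ) : Finset (BS m n) :=
  (Set.finite_range (PresentedGroup.of : Fin 2 → BS m n)).toFinset

theorem closure_gens (m n : ℤ) : Subgroup.closure (gens m n : Set (BS m n)) = ⊤ := by
  simp [gens, PresentedGroup.closure_range_of]

theorem vert_mem (m n : ℤ) : vert m n ∈ (gens m n : Set (BS m n)) := by
  simp [gens, vert]

theorem letter_true_mem (m n : ℤ) : letter m n true ∈ (gens m n : Set (BS m n)) := by
  simp [gens, letter]

theorem eq_of_mem_gens {m n : ℤ} {s : BS m n} (hs : s ∈ (gens m n : Set (BS m n))) :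
    s = letter m n true ∨ s = vert m n := by
  simp only [gens, Set.Finite.coe_toFinset, Set.mem_range] at hs
  obtain ⟨i, rfl⟩ := hs
  fin_cases i
  exacts [Or.inl rfl, Or.inr rfl]

variable {m n : ℤ}

theorem letter_mul_letter (e : Bool) : letter m n (!e) * letter m n e = 1 := by
  cases e <;> simp [letter]

theorem reach_letter (e : Bool) (g : BS m n) :
    Reach (gens m n : Set (BS m n)) 1 g (g * letter m n e) := by
  cases e
  · have h := letter_mul_letter (m := m) (n := n) true
    have := (Reach.mul_right (letter_true_mem m n) (g * letter m n false)).symm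
    rwa [mul_assoc, show letter m n false * letter m n true = 1 from h, mul_one] at this
  · exact Reach.mul_right (letter_true_mem m n) g

theorem relation : letter m n true * vert m n ^ m = vert m n ^ n * letter m n true := by
  have h : PresentedGroup.mk (BSRels m n) (FreeGroup.of 0 * FreeGroup.of 1 ^ m *
      (FreeGroup.of 0)⁻¹ * (FreeGroup.of 1 ^ n)⁻¹) = 1 :=
    PresentedGroup.one_of_mem rfl
  simp only [map_mul, map_inv, map_zpow] at h
  exact mul_inv_eq_iff_eq_mul.1 (mul_inv_eq_one.1 h)

theorem letter_mul_zpow (e : Bool) (k : ℤ) :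
    letter m n e * vert m n ^ (bound m n (!e) * k) =
      vert m n ^ (bound m n e * k) * letter m n e := by
  have h : SemiconjBy (letter m n true) (vert m n ^ m) (vert m n ^ n) := relation
  simp only [zpow_mul]
  cases e
  · exact ((h.inv_symm_left).zpow_right k).eq
  · exact (h.zpow_right k).eq

variable {d : ℕ} (D : EdgeCoding (bound m n) d)

/-- The group element with a given normal form, for the reference point over a vertex. -/
def vertexElt : TwoTree d → BS m n
  | base b => if b then 1 else letter m n false
  | child v c => vertexElt v * vert m n ^ D.ind (D.last v) c * letter m n (D.sgn (D.last v) c)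

/-- The group element with a given normal form. -/
def elt (s : TwoTree d × ℤ) : BS m n := vertexElt D s.1 * vert m n ^ s.2

theorem vertexElt_par (v : TwoTree d) :
    vertexElt D v = vertexElt D (EdgeCoding.par v) * vert m n ^ D.idx v *
      letter m n (D.last v) := by
  cases v with
  | base b =>
    cases b <;> simp [vertexElt, EdgeCoding.par, EdgeCoding.idx, EdgeCoding.last, letter]
  | child v c => rfl

theorem elt_step (hN : ∀ b, 0 < bound m n b) (e : Bool) (s : TwoTree d × ℤ) :
    elt D (D.step e s) = elt D s * letter m n e := by
  have key : ∀ v j, elt D (EdgeCoding.par v, D.idx v + bound m n (D.last v) * j) *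
      letter m n (D.last v) = elt D (v, bound m n (!D.last v) * j) := by
    intro v j
    simp only [elt]
    rw [vertexElt_par D v, zpow_add]
    simp only [mul_assoc, letter_mul_zpow]
  rcases D.step_cases hN e s with ⟨h1, h2, h3⟩ | ⟨c, h1, h2, h3⟩
  · rw [h3]
    subst h1
    have := key s.1 (s.2 / bound m n (!D.last s.1))
    rw [← h2] at this
    rw [← Prod.mk.eta (p := s), ← this, mul_assoc]
    have hl := letter_mul_letter (m := m) (n := n) (!D.last s.1)
    rw [Bool.not_not] at hl
    simp [hl]
  · rw [h3]
    subst h1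
    have := key (child s.1 c) (s.2 / bound m n (D.last (child s.1 c)))
    rw [← h2] at this
    exact this.symm

/-- The action of `vert` on normal forms. -/
def shift (d : ℕ) : Equiv.Perm (TwoTree d × ℤ) :=
  Equiv.prodCongr (Equiv.refl _) (Equiv.addRight 1)

theorem shift_zpow (k : ℤ) (s : TwoTree d × ℤ) : (shift d ^ k) s = (s.1, s.2 + k) := by
  induction k with
  | zero => simp
  | succ i ih =>
    rw [add_comm (i : ℤ) 1, zpow_one_add, Equiv.Perm.mul_apply, ih]
    simp [shift, add_assoc, add_comm]
  | pred i ih =>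
    rw [sub_eq_neg_add, zpow_add, Equiv.Perm.mul_apply, ih, zpow_neg_one, Equiv.Perm.inv_eq_iff_eq]
    simp only [shift, Equiv.prodCongr_apply, Prod.map_apply, Equiv.refl_apply,
      Equiv.coe_addRight, Prod.mk.injEq, true_and]
    ring

/-- The right action of the group on normal forms. -/
noncomputable def action (hN : ∀ b, 0 < bound m n b) :
    BS m n →* (Equiv.Perm (TwoTree d × ℤ))ᵐᵒᵖ :=
  PresentedGroup.toGroup (f := ![op (D.stepPerm hN), op (shift d)]) (by
    rintro r rfl
    have h : shift d ^ m * D.stepPerm hN = D.stepPerm hN * shift d ^ n := by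
      ext1 s
      have := D.step_add hN true s.1 s.2 1
      simp only [Equiv.Perm.mul_apply, shift_zpow]
      simpa [bound, EdgeCoding.stepPerm] using this.symm
    simp only [map_mul, map_inv, map_zpow, FreeGroup.lift_apply_of, Matrix.cons_val_zero,
      Matrix.cons_val_one]
    rw [mul_inv_eq_one, mul_inv_eq_iff_eq_mul]
    simpa using congrArg op h)

theorem action_letter (hN : ∀ b, 0 < bound m n b) (e : Bool) (s : TwoTree d × ℤ) :
    (action D hN (letter m n e)).unop s = D.step e s := by
  cases e
  · simp only [letter, action, Bool.false_eq_true, if_false, map_inv, PresentedGroup.toGroup.of]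
    rfl
  · simp only [letter, action, if_true, PresentedGroup.toGroup.of]
    rfl

theorem action_vert (hN : ∀ b, 0 < bound m n b) (k : ℤ) (s : TwoTree d × ℤ) :
    (action D hN (vert m n ^ k)).unop s = (s.1, s.2 + k) := by
  rw [← shift_zpow, map_zpow]
  simp [vert, action]

theorem elt_action (hN : ∀ b, 0 < bound m n b) (g : BS m n) (s : TwoTree d × ℤ) :
    elt D ((action D hN g).unop s) = elt D s * g := by
  have hg : g ∈ Subgroup.closure (gens m n : Set (BS m n)) := by rw [closure_gens]; trivial
  induction hg using Subgroup.closure_induction generalizing s with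
  | mem x hx =>
    rcases eq_of_mem_gens hx with rfl | rfl
    · rw [action_letter, elt_step D hN]
    · have := action_vert D hN 1 s
      rw [zpow_one] at this
      rw [this, elt, elt, zpow_add_one, mul_assoc]
  | one => simp
  | mul x y _ _ hx hy => rw [map_mul, unop_mul, Equiv.Perm.mul_apply, hy, hx, mul_assoc]
  | inv x _ hx =>
    rw [eq_mul_inv_iff_mul_eq, ← hx, ← Equiv.Perm.mul_apply, ← unop_mul, ← map_mul]
    simp

theorem action_elt (hN : ∀ b, 0 < bound m n b) (s : TwoTree d × ℤ) :
    (action D hN (elt D s)).unop (base true, 0) = s := by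
  have hstep : ∀ v, (action D hN (vertexElt D (EdgeCoding.par v))).unop (base true, 0) =
      (EdgeCoding.par v, 0) → (action D hN (vertexElt D v)).unop (base true, 0) = (v, 0) := by
    intro v hv
    have := D.step_par hN v 0
    rw [mul_zero, mul_zero, add_zero] at this
    rw [vertexElt_par, map_mul, map_mul, unop_mul, unop_mul, Equiv.Perm.mul_apply,
      Equiv.Perm.mul_apply, hv, action_vert, action_letter, zero_add, this]
  have hv : ∀ v, (action D hN (vertexElt D v)).unop (base true, 0) = (v, 0) := by
    intro v
    induction v with
    | base b =>
      cases b
      · exact hstep (base false) (by simp [EdgeCoding.par, vertexElt])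
      · simp [vertexElt]
    | child v c ih => exact hstep (child v c) ih
  rw [elt, map_mul, unop_mul, Equiv.Perm.mul_apply, hv, action_vert, zero_add]

/-- The normal form of a group element. -/
noncomputable def normalForm (hN : ∀ b, 0 < bound m n b) : BS m n ≃ TwoTree d × ℤ where
  toFun g := (action D hN g).unop (base true, 0)
  invFun := elt D
  left_inv g := by rw [elt_action]; simp [elt, vertexElt]
  right_inv := action_elt D hN

theorem normalForm_mul_letter (hN : ∀ b, 0 < bound m n b) (g : BS m n) (e : Bool) :
    normalForm D hN (g * letter m n e) = D.step e (normalForm D hN g) := by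
  simp [normalForm, action_letter]

theorem normalForm_mul_zpow (hN : ∀ b, 0 < bound m n b) (g : BS m n) (k : ℤ) :
    normalForm D hN (g * vert m n ^ k) =
      ((normalForm D hN g).1, (normalForm D hN g).2 + k) := by
  simp only [normalForm, Equiv.coe_fn_mk, map_mul, unop_mul, Equiv.Perm.mul_apply, action_vert]

/-! #### Quantitative control of the word metric by normal forms -/

section Metric

variable (hN : ∀ b, 0 < bound m n b)

/-- The vertex of the tree under a group element. -/
noncomputable def proj (g : BS m n) : TwoTree d := (normalForm D hN g).1

/-- The height on the tree associated with the group. -/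
noncomputable def treeHeight : TwoTree d → ℝ :=
  D.height (Real.log (bound m n true / bound m n false))

/-- The real coordinate of a group element. -/
noncomputable def realCoord (g : BS m n) : ℝ :=
  D.coord (Real.log (bound m n true / bound m n false)) (normalForm D hN g)

theorem proj_mul_zpow (g : BS m n) (k : ℤ) :
    proj D hN (g * vert m n ^ k) = proj D hN g := by
  simp [proj, normalForm_mul_zpow]

theorem realCoord_mul_zpow (g : BS m n) (k : ℤ) :
    realCoord D hN (g * vert m n ^ k) =
      realCoord D hN g + Real.exp (treeHeight D (proj D hN g)) * k := by
  simp only [realCoord, normalForm_mul_zpow, EdgeCoding.coord, proj, treeHeight]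
  push_cast
  ring

theorem realCoord_mul_letter (g : BS m n) (e : Bool) :
    realCoord D hN (g * letter m n e) = realCoord D hN g := by
  rw [realCoord, normalForm_mul_letter, D.coord_step hN, realCoord]

theorem adj_proj_mul_letter (g : BS m n) (e : Bool) :
    Adj (proj D hN g) (proj D hN (g * letter m n e)) := by
  rw [proj, proj, normalForm_mul_letter]
  exact D.adj_step hN e _

theorem exists_mul_zpow_eq {g g' : BS m n} (h : proj D hN g = proj D hN g') :
    ∃ k : ℤ, g' = g * vert m n ^ k := by
  refine ⟨(normalForm D hN g').2 - (normalForm D hN g).2, (normalForm D hN).injective ?_⟩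
  rw [normalForm_mul_zpow]
  exact Prod.ext h.symm (by ring)

theorem exists_proj_realCoord (v : TwoTree d) (r : ℝ) :
    ∃ g, proj D hN g = v ∧ |r - realCoord D hN g| ≤ Real.exp (treeHeight D v) := by
  obtain ⟨g, hg⟩ := (normalForm D hN).surjective (v, 0)
  have hgv : proj D hN g = v := by rw [proj, hg]
  have hpos := Real.exp_pos (treeHeight D v)
  refine ⟨g * vert m n ^ ⌊(r - realCoord D hN g) / Real.exp (treeHeight D v)⌋,
    by rw [proj_mul_zpow, hgv], ?_⟩
  rw [realCoord_mul_zpow, hgv]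
  have h1 := Int.floor_le ((r - realCoord D hN g) / Real.exp (treeHeight D v))
  have h2 := Int.lt_floor_add_one ((r - realCoord D hN g) / Real.exp (treeHeight D v))
  rw [le_div_iff₀ hpos] at h1
  rw [div_lt_iff₀ hpos] at h2
  rw [abs_le]
  constructor <;> linarith

variable (hmn : m < n)
include hmn

include hN in
theorem log_pos : 0 < Real.log (bound m n true / bound m n false) := by
  have hf : (0 : ℝ) < bound m n false := by exact_mod_cast hN false
  apply Real.log_pos
  rw [one_lt_div hf]
  exact_mod_cast hmn

theorem exists_reach_of_adj {g : BS m n} {w : TwoTree d} (h : Adj (proj D hN g) w) :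
    ∃ g', proj D hN g' = w ∧ Reach (gens m n : Set (BS m n)) (n.natAbs + 1) g g' ∧
      |realCoord D hN g - realCoord D hN g'| ≤
        (n.natAbs + 1) * Real.exp (treeHeight D (proj D hN g)) := by
  obtain ⟨e, j, hj⟩ := D.exists_step_of_adj hN h
  obtain ⟨k, hk⟩ : ∃ k, k = j % bound m n e - (normalForm D hN g).2 % bound m n e := ⟨_, rfl⟩
  have hkn : k.natAbs ≤ n.natAbs := by
    have h1 := Int.emod_nonneg j (hN e).ne'
    have h2 := Int.emod_lt_of_pos j (hN e)
    have h3 := Int.emod_nonneg (normalForm D hN g).2 (hN e).ne'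
    have h4 := Int.emod_lt_of_pos (normalForm D hN g).2 (hN e)
    have h5 : bound m n e ≤ n := by cases e <;> simp [bound, hmn.le]
    omega
  have hmod : ((normalForm D hN g).2 + k) % bound m n e = j % bound m n e := by
    rw [hk, Int.add_emod, Int.sub_emod, Int.emod_emod, Int.emod_emod, ← Int.sub_emod,
      ← Int.add_emod, add_sub_cancel]
  refine ⟨g * vert m n ^ k * letter m n e, ?_, ?_, ?_⟩
  · rw [proj, normalForm_mul_letter, normalForm_mul_zpow, ← hj]
    exact D.step_fst e _ hmod
  · exact ((Reach.mul_zpow (vert_mem m n) g k).mono hkn).trans (reach_letter e _)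
  · rw [realCoord_mul_letter, realCoord_mul_zpow, sub_add_cancel_left, abs_neg, abs_mul,
      abs_of_pos (Real.exp_pos _), mul_comm]
    refine mul_le_mul_of_nonneg_right ?_ (Real.exp_pos _).le
    rw [← Int.cast_abs, Int.abs_eq_natAbs, Int.cast_natCast]
    exact_mod_cast hkn.trans (Nat.le_succ _)

theorem exists_reach_of_near {k : ℕ} {g : BS m n} {w : TwoTree d}
    (h : Near k (proj D hN g) w) :
    ∃ g', proj D hN g' = w ∧ Reach (gens m n : Set (BS m n)) (k * (n.natAbs + 1)) g g' ∧
      |realCoord D hN g - realCoord D hN g'| ≤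
        k * (n.natAbs + 1) * Real.exp (k * Real.log (bound m n true / bound m n false)) *
          Real.exp (treeHeight D (proj D hN g)) := by
  have ha := log_pos hN hmn
  obtain ⟨v, hv⟩ : ∃ v, v = proj D hN g := ⟨_, rfl⟩
  rw [← hv] at h ⊢
  induction h with
  | refl k v =>
    refine ⟨g, hv.symm, Reach.refl _ _, ?_⟩
    rw [sub_self, abs_zero]
    positivity
  | @step k u v w huv hvw ih =>
    obtain ⟨g₁, rfl, hr, hc⟩ := ih hv
    obtain ⟨g₂, hg₂, hr₂, hc₂⟩ := exists_reach_of_adj D hN hmn hvw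
    refine ⟨g₂, hg₂, (hr.trans hr₂).mono (by rw [add_mul, one_mul]), ?_⟩
    have hh := (abs_le.1 (D.height_near ha huv)).1
    refine (abs_sub_le _ (realCoord D hN g₁) _).trans ((add_le_add hc hc₂).trans ?_)
    have e1 : Real.exp (treeHeight D (proj D hN g₁)) ≤
        Real.exp ((k + 1 : ℕ) * Real.log (bound m n true / bound m n false)) *
          Real.exp (treeHeight D u) := by
      rw [← Real.exp_add, Real.exp_le_exp, treeHeight]
      push_cast
      linarith
    have e2 : Real.exp (k * Real.log (bound m n true / bound m n false)) ≤
        Real.exp ((k + 1 : ℕ) * Real.log (bound m n true / bound m n false)) := by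
      rw [Real.exp_le_exp]
      push_cast
      linarith
    calc _ ≤ k * (n.natAbs + 1) *
          Real.exp ((k + 1 : ℕ) * Real.log (bound m n true / bound m n false)) *
            Real.exp (treeHeight D u) + (n.natAbs + 1) *
          (Real.exp ((k + 1 : ℕ) * Real.log (bound m n true / bound m n false)) *
          Real.exp (treeHeight D u)) := by gcongr
      _ = _ := by push_cast; ring

/-- Group elements over nearby vertices with nearby real coordinates are close. -/
theorem exists_reach_bound (k : ℕ) (r : ℝ) :
    ∃ B : ℕ, ∀ g g', Near k (proj D hN g) (proj D hN g') →
      |realCoord D hN g - realCoord D hN g'| ≤ r * Real.exp (treeHeight D (proj D hN g)) →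
      Reach (gens m n : Set (BS m n)) B g g' := by
  have ha := log_pos hN hmn
  obtain ⟨A, hA⟩ : ∃ A, A = Real.exp (k * Real.log (bound m n true / bound m n false)) := ⟨_, rfl⟩
  obtain ⟨B, hB⟩ := exists_nat_ge (((k * (n.natAbs + 1) * A) + |r|) * A)
  refine ⟨k * (n.natAbs + 1) + B, fun g g' hnear hc => ?_⟩
  obtain ⟨g₁, hg₁, hr, hc₁⟩ := exists_reach_of_near D hN hmn hnear
  obtain ⟨j, rfl⟩ := exists_mul_zpow_eq D hN hg₁
  refine hr.trans ((Reach.mul_zpow (vert_mem m n) g₁ j).mono ?_)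
  rw [realCoord_mul_zpow] at hc
  rw [proj_mul_zpow] at hnear
  have hpos := Real.exp_pos (treeHeight D (proj D hN g₁))
  have hh : Real.exp (treeHeight D (proj D hN g)) ≤
      A * Real.exp (treeHeight D (proj D hN g₁)) := by
    rw [hA, ← Real.exp_add, Real.exp_le_exp]
    have := (abs_le.1 (D.height_near ha hnear)).2
    rw [treeHeight]
    linarith
  rw [← hA] at hc₁
  have hA0 : 0 < A := hA ▸ Real.exp_pos _
  have key : Real.exp (treeHeight D (proj D hN g₁)) * |(j : ℝ)| ≤
      ((k * (n.natAbs + 1) * A) + |r|) * Real.exp (treeHeight D (proj D hN g)) := by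
    rw [← abs_of_pos hpos, ← abs_mul]
    have hrr := mul_le_mul_of_nonneg_right (le_abs_self r)
      (Real.exp_pos (treeHeight D (proj D hN g))).le
    rw [abs_le] at hc hc₁ ⊢
    constructor <;> linarith [hc.1, hc.2, hc₁.1, hc₁.2]
  have hj : |(j : ℝ)| ≤ B := by
    refine le_trans (le_of_mul_le_mul_left (key.trans ?_) hpos) hB
    calc _ ≤ ((k * (n.natAbs + 1) * A) + |r|) *
          (A * Real.exp (treeHeight D (proj D hN g₁))) := by gcongr
      _ = _ := by ring
  rw [← Int.cast_abs, Int.abs_eq_natAbs, Int.cast_natCast] at hj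
  exact_mod_cast hj

/-- A coarse form of the previous bound for the two ends of a generator, seen from another
group. -/
theorem exists_generator_bound {d' : ℕ} {p q : ℤ} (D' : EdgeCoding (bound p q) d')
    (hN' : ∀ b, 0 < bound p q b) (hpq : p < q)
    {R : TwoTree d → TwoTree d' → Prop} {K : ℕ} {C : ℝ}
    (hC : ∀ u u', R u u' → |treeHeight D u - treeHeight D' u'| ≤ C)
    (hK : ∀ u w u' w', (w = u ∨ Adj u w) → R u u' → R w w' → Near K u' w') (r : ℝ) :
    ∃ B : ℕ, ∀ g g' h h', (g' = g ∨ ∃ s ∈ (gens m n : Set (BS m n)), g' = g * s) →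
      (R (proj D hN g) (proj D' hN' h) ∧ |realCoord D hN g - realCoord D' hN' h| ≤
        r * Real.exp (treeHeight D (proj D hN g))) →
      (R (proj D hN g') (proj D' hN' h') ∧ |realCoord D hN g' - realCoord D' hN' h'| ≤
        r * Real.exp (treeHeight D (proj D hN g'))) →
      Reach (gens p q : Set (BS p q)) B h h' := by
  have ha := log_pos hN hmn
  obtain ⟨A, hA⟩ : ∃ A, A = Real.exp (Real.log (bound m n true / bound m n false)) := ⟨_, rfl⟩
  have hA1 : 0 ≤ A := hA ▸ (Real.exp_pos _).le
  obtain ⟨B, hB⟩ := exists_reach_bound D' hN' hpq K ((|r| + |r| * A + 1) * Real.exp C)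
  refine ⟨B, fun g g' h h' hg hR hR' => ?_⟩
  have hstep : (proj D hN g' = proj D hN g ∨ Adj (proj D hN g) (proj D hN g')) ∧
      |realCoord D hN g - realCoord D hN g'| ≤ Real.exp (treeHeight D (proj D hN g)) := by
    have hpos := (Real.exp_pos (treeHeight D (proj D hN g))).le
    rcases hg with rfl | ⟨s, hs, rfl⟩
    · exact ⟨Or.inl rfl, by simpa using hpos⟩
    · rcases eq_of_mem_gens hs with rfl | rfl
      · exact ⟨Or.inr (adj_proj_mul_letter D hN g true), by
          rw [realCoord_mul_letter]; simpa using hpos⟩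
      · have h1 := proj_mul_zpow D hN g 1
        have h2 := realCoord_mul_zpow D hN g 1
        rw [zpow_one] at h1 h2
        exact ⟨Or.inl h1, by rw [h2]; simp⟩
  refine hB h h' (hK _ _ _ _ hstep.1 hR.1 hR'.1) ?_
  have hh : Real.exp (treeHeight D (proj D hN g')) ≤
      A * Real.exp (treeHeight D (proj D hN g)) := by
    rw [hA, ← Real.exp_add, Real.exp_le_exp]
    rcases hstep.1 with h1 | h1
    · rw [h1]
      linarith
    · have := (abs_le.1 (D.height_adj ha h1)).1
      rw [treeHeight]
      linarith
  have hhC : Real.exp (treeHeight D (proj D hN g)) ≤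
      Real.exp C * Real.exp (treeHeight D' (proj D' hN' h)) := by
    rw [← Real.exp_add, Real.exp_le_exp]
    linarith [(abs_le.1 (hC _ _ hR.1)).2]
  have k1 := abs_sub_le (realCoord D' hN' h) (realCoord D hN g) (realCoord D' hN' h')
  have k2 := abs_sub_le (realCoord D hN g) (realCoord D hN g') (realCoord D' hN' h')
  rw [abs_sub_comm (realCoord D' hN' h) (realCoord D hN g)] at k1
  have k3 := mul_le_mul_of_nonneg_right (le_abs_self r)
    (Real.exp_pos (treeHeight D (proj D hN g))).le
  have k4 : r * Real.exp (treeHeight D (proj D hN g')) ≤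
      |r| * (A * Real.exp (treeHeight D (proj D hN g))) := by
    refine (mul_le_mul_of_nonneg_right (le_abs_self r) (Real.exp_pos _).le).trans ?_
    gcongr
  calc _ ≤ (|r| + |r| * A + 1) * Real.exp (treeHeight D (proj D hN g)) := by
        linarith [hR.2, hR'.2, hstep.2]
    _ ≤ (|r| + |r| * A + 1) * (Real.exp C * Real.exp (treeHeight D' (proj D' hN' h))) := by
        gcongr
    _ = _ := by ring

end Metric

end BS

/-- All the higher Baumslag–Solitar groups `BS(m,n)`, `1 < m < n`, are
quasi-isometric to each other. -/
theorem higher_BS_quasiIsometric (m n p q : ℤ) (hm : 1 < m) (hmn : m < n)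
    (hp : 1 < p) (hpq : p < q) :
    QuasiIsometricGroups (BS m n) (BS p q) := by
  have hN1 : ∀ b, 1 < BS.bound m n b := fun b => by cases b <;> simp [BS.bound] <;> omega
  have hN1' : ∀ b, 1 < BS.bound p q b := fun b => by cases b <;> simp [BS.bound] <;> omega
  have hN : ∀ b, 0 < BS.bound m n b := fun b => zero_lt_one.trans (hN1 b)
  have hN' : ∀ b, 0 < BS.bound p q b := fun b => zero_lt_one.trans (hN1' b)
  obtain ⟨d, hd⟩ : ∃ d : ℕ, (d : ℤ) + 2 = n + m := ⟨(n + m - 2).toNat, by omega⟩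
  obtain ⟨d', hd'⟩ : ∃ d' : ℕ, (d' : ℤ) + 2 = q + p := ⟨(q + p - 2).toNat, by omega⟩
  obtain ⟨D⟩ := EdgeCoding.exists_of_card hN hd
  obtain ⟨D'⟩ := EdgeCoding.exists_of_card hN' hd'
  have : NeZero d := ⟨by omega⟩
  have : NeZero d' := ⟨by omega⟩
  obtain ⟨R, K, C, hR, hR', hC, hK, hK'⟩ :=
    (D.isHeight (BS.log_pos hN hmn) hN1).exists_corr (D'.isHeight (BS.log_pos hN' hpq) hN1')
  have hCr : ∀ u u', R u u' → Real.exp (BS.treeHeight D' u') ≤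
      Real.exp C * Real.exp (BS.treeHeight D u) := fun u u' h => by
    rw [← Real.exp_add, Real.exp_le_exp]
    have := (abs_le.1 (hC u u' h)).1
    simp only [BS.treeHeight]
    linarith
  have hCl : ∀ u u', R u u' → Real.exp (BS.treeHeight D u) ≤
      Real.exp C * Real.exp (BS.treeHeight D' u') := fun u u' h => by
    rw [← Real.exp_add, Real.exp_le_exp]
    have := (abs_le.1 (hC u u' h)).2
    simp only [BS.treeHeight]
    linarith
  have hC1 : 1 ≤ Real.exp C := by
    obtain ⟨u', hu'⟩ := hR (TwoTree.base true)
    exact Real.one_le_exp ((abs_nonneg _).trans (hC _ _ hu'))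
  obtain ⟨B, hB⟩ := BS.exists_generator_bound D hN hmn D' hN' hpq hC hK (Real.exp C)
  obtain ⟨B', hB'⟩ := BS.exists_generator_bound D' hN' hpq D hN hmn
    (R := fun u' u => R u u') (fun u' u h => by rw [abs_sub_comm]; exact hC u u' h)
    (fun u' w' u w => hK' u w u' w') (Real.exp C * Real.exp C)
  refine QuasiIsometricGroups.of_correspondence (BS.gens m n) (BS.gens p q)
    (BS.closure_gens m n) (BS.closure_gens p q)
    (fun g h => R (BS.proj D hN g) (BS.proj D' hN' h) ∧
      |BS.realCoord D hN g - BS.realCoord D' hN' h| ≤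
        Real.exp C * Real.exp (BS.treeHeight D (BS.proj D hN g))) ?_ ?_ (B + B') ?_ ?_
  · intro g
    obtain ⟨u', hu'⟩ := hR (BS.proj D hN g)
    obtain ⟨h, rfl, hh⟩ := BS.exists_proj_realCoord D' hN' u' (BS.realCoord D hN g)
    exact ⟨h, hu', hh.trans (hCr _ _ hu')⟩
  · intro h
    obtain ⟨u, hu⟩ := hR' (BS.proj D' hN' h)
    obtain ⟨g, rfl, hg⟩ := BS.exists_proj_realCoord D hN u (BS.realCoord D' hN' h)
    refine ⟨g, hu, ?_⟩
    rw [abs_sub_comm]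
    exact hg.trans (le_mul_of_one_le_left (Real.exp_pos _).le hC1)
  · exact fun g g' h h' hg hh hh' => (hB g g' h h' hg hh hh').mono (by omega)
  · have hflip : ∀ g h, (R (BS.proj D hN g) (BS.proj D' hN' h) ∧
        |BS.realCoord D hN g - BS.realCoord D' hN' h| ≤
          Real.exp C * Real.exp (BS.treeHeight D (BS.proj D hN g))) →
        R (BS.proj D hN g) (BS.proj D' hN' h) ∧
        |BS.realCoord D' hN' h - BS.realCoord D hN g| ≤
          Real.exp C * Real.exp C * Real.exp (BS.treeHeight D' (BS.proj D' hN' h)) := by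
      rintro g h ⟨h1, h2⟩
      refine ⟨h1, ?_⟩
      rw [abs_sub_comm, mul_assoc]
      exact h2.trans (mul_le_mul_of_nonneg_left (hCl _ _ h1) (Real.exp_pos C).le)
    exact fun h h' g g' hh hg hg' =>
      (hB' h h' g g' hh (hflip g h hg) (hflip g' h' hg')).mono (by omega)
end

section
/- Let T be a nonempty homogeneous coarsely oriented tree with height function h. Then exactly one of the following holds: (1) h is constant; (2) either every vertex of T has exactly one neighbor of strictly greater height and all its other neighbors have strictly smaller height, or every vertex has exactly one neighbor of strictly smaller height and all its other neighbors have strictly greater height; (3) there exists a coarsely orientation preserving quasi-isometry from T to the oriented tree of type (2,2). -/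
/-- A coarsely orientation preserving quasi-isometry between coarsely oriented trees:
a quasi-isometry for the graph metrics which moreover coarsely preserves height
changes. -/
def IsCOPQuasiIsometry {V₁ V₂ : Type*} (G₁ : SimpleGraph V₁) (h₁ : V₁ → ℝ)
    (G₂ : SimpleGraph V₂) (h₂ : V₂ → ℝ) (f : V₁ → V₂) : Prop :=
  IsQuasiIsometry (fun u v => (G₁.dist u v : ℝ)) (fun u v => (G₂.dist u v : ℝ)) f ∧
    ∃ C' : ℝ, 0 ≤ C' ∧ ∀ u v : V₁, |(h₂ (f v) - h₂ (f u)) - (h₁ v - h₁ u)| ≤ C'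

/-- A coarsely oriented tree is homogeneous if the multiset of height changes along the
edges incident to a vertex is the same for all vertices; equivalently there is a
bijection between the neighbor sets of any two vertices matching height changes. -/
def Homogeneous {V : Type*} (G : SimpleGraph V) (h : V → ℝ) : Prop :=
  ∀ v w : V, ∃ σ : G.neighborSet v ≃ G.neighborSet w,
    ∀ u : G.neighborSet v, h u - h v = h (σ u) - h w

/-- The oriented tree of type `(2,2)`: the Cayley graph of the free group on two
generators. -/
def T22 : SimpleGraph (FreeGroup Bool) :=
  SimpleGraph.fromRel (fun g g' => ∃ i : Bool, g' = g * FreeGroup.of i)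

/-- The height function on the oriented tree of type `(2,2)`: the exponent sum. -/
noncomputable def h22 : FreeGroup Bool → ℝ :=
  fun g => ((Multiplicative.toAdd ((FreeGroup.lift fun _ => Multiplicative.ofAdd (1 : ℤ)) g) : ℤ) : ℝ)

theorem exists_natLog_mul_add_le (δ D C : ℝ) (hδ : 0 < δ) :
    ∃ t₀ : ℕ, ∀ t ≥ t₀, ((Nat.log 2 t : ℕ) + 2 : ℝ) * D + C ≤ ((t / 4 : ℕ) : ℝ) * δ := by
  have hlim : Filter.Tendsto (fun t : ℕ => Real.log t / t) Filter.atTop (nhds 0) := by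
    have := Real.isLittleO_log_id_atTop.tendsto_div_nhds_zero
    exact this.comp tendsto_natCast_atTop_atTop
  have hlog₂ : 0 < Real.log 2 := Real.log_pos (by norm_num)
  set A := |D| / Real.log 2 with hA
  have hA₀ : 0 ≤ A := by positivity
  have h₁ : ∀ᶠ t : ℕ in Filter.atTop, Real.log t / t < δ / (8 * (A + 1)) :=
    hlim.eventually_lt_const (by positivity)
  have h₂ : ∀ᶠ t : ℕ in Filter.atTop, (2 * |D| + C + δ) * 8 / δ ≤ t :=
    tendsto_natCast_atTop_atTop.eventually_ge_atTop _
  obtain ⟨t₀, ht₀⟩ := Filter.eventually_atTop.1 (h₁.and h₂)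
  refine ⟨t₀ + 1, fun t ht => ?_⟩
  obtain ⟨h₃, h₄⟩ := ht₀ t (by omega)
  have ht₁ : (0 : ℝ) < t := by exact_mod_cast (by omega : 0 < t)
  rw [div_lt_iff₀ ht₁, div_mul_eq_mul_div, lt_div_iff₀ (by positivity)] at h₃
  rw [div_le_iff₀ hδ] at h₄
  have h₅ : (Nat.log 2 t : ℝ) * Real.log 2 ≤ Real.log t := by
    rw [← Real.log_pow]
    refine Real.log_le_log (by positivity) ?_
    exact_mod_cast Nat.pow_log_le_self 2 (by omega)
  have h₆ : (t : ℝ) ≤ 4 * ((t / 4 : ℕ) : ℝ) + 4 := by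
    exact_mod_cast (by omega : t ≤ 4 * (t / 4) + 4)
  have h₇ : (Nat.log 2 t : ℝ) * D ≤ Real.log t * A := by
    rw [hA, ← mul_div_assoc, le_div_iff₀ hlog₂]
    calc (Nat.log 2 t : ℝ) * D * Real.log 2 = (Nat.log 2 t * Real.log 2) * D := by ring
      _ ≤ (Nat.log 2 t * Real.log 2) * |D| :=
        mul_le_mul_of_nonneg_left (le_abs_self D) (by positivity)
      _ ≤ _ := mul_le_mul_of_nonneg_right h₅ (abs_nonneg D)
  have h₈ : 0 ≤ Real.log t := Real.log_natCast_nonneg t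
  have h₉ := mul_le_mul_of_nonneg_right h₆ hδ.le
  nlinarith [le_abs_self D]

/-- A locally finite rooted tree, presented by its parent map, depth function and children. -/
structure ParentTree (V : Type*) where
  root : V
  parent : V → V
  depth : V → ℕ
  children : V → Finset V
  mem_children {u v : V} : u ∈ children v ↔ u ≠ root ∧ parent u = v
  depth_parent {u : V} : u ≠ root → depth u = depth (parent u) + 1

namespace ParentTree

variable {V : Type*} (T : ParentTree V)

theorem depth_of_mem_children {u v : V} (hu : u ∈ T.children v) : T.depth u = T.depth v + 1 := by
  obtain ⟨h₁, rfl⟩ := T.mem_children.1 hu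
  exact T.depth_parent h₁

theorem induction_parent {P : V → Prop} (root : P T.root)
    (step : ∀ v, v ≠ T.root → P (T.parent v) → P v) (v : V) : P v := by
  induction hd : T.depth v using Nat.strong_induction_on generalizing v with
  | _ d ih =>
    by_cases hv : v = T.root
    · exact hv ▸ root
    · exact step v hv (ih _ (by rw [← hd, T.depth_parent hv]; omega) _ rfl)

/-- Functions on a rooted tree can be defined by recursion along the parent map. -/
theorem exists_rec {S : Type*} (s₀ : S) (g : V → S → S) :
    ∃ s : V → S, s T.root = s₀ ∧ ∀ v, v ≠ T.root → s v = g v (s (T.parent v)) := by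
  classical
  let step : ℕ → (V → S) → V → S := fun _ s v => if v = T.root then s₀ else g v (s (T.parent v))
  let iter : ℕ → V → S := fun k => Nat.rec (fun _ => s₀) step k
  have stable : ∀ v k, T.depth v ≤ k → iter (k + 1) v = iter (T.depth v + 1) v := by
    intro v
    induction v using T.induction_parent with
    | root => intro k _; simp [iter, step]
    | step v hv ih =>
      intro k hk
      rw [T.depth_parent hv] at hk ⊢
      obtain ⟨k, rfl⟩ : ∃ j, k = j + 1 := ⟨k - 1, by omega⟩
      have e : ∀ j, iter (j + 1) v = g v (iter j (T.parent v)) := fun j => by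
        simp [iter, step, hv]
      exact (e (k + 1)).trans
        ((congrArg (g v) (ih k (by omega))).trans (e (T.depth (T.parent v) + 1)).symm)
  refine ⟨fun v => iter (T.depth v + 1) v, by simp [iter, step], fun v hv => ?_⟩
  have e : ∀ j, iter (j + 1) v = g v (iter j (T.parent v)) := fun j => by
    simp [iter, step, hv]
  simp only [e, T.depth_parent hv]

theorem pairwiseDisjoint_children (s : Set V) : s.PairwiseDisjoint T.children := by
  intro x _ y _ hxy
  refine Finset.disjoint_left.2 fun a ha hb => hxy ?_
  rw [← (T.mem_children.1 ha).2, (T.mem_children.1 hb).2]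

/-- A finite subtree with top vertex `v`. -/
structure IsBlock (v : V) (X : Finset V) : Prop where
  mem : v ∈ X
  closed : ∀ x ∈ X, x ≠ v → x ≠ T.root ∧ T.parent x ∈ X

variable {T} in
theorem IsBlock.depth_le {v x : V} {X : Finset V} (hX : T.IsBlock v X) (hx : x ∈ X) :
    T.depth v ≤ T.depth x := by
  induction x using T.induction_parent with
  | root =>
    by_cases h : T.root = v
    · rw [h]
    · exact absurd rfl (hX.closed _ hx h).1
  | step x hr ih =>
    by_cases h : x = v
    · rw [h]
    · rw [T.depth_parent hr]
      exact (ih (hX.closed x hx h).2).trans (Nat.le_succ _)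

variable {T} in
theorem IsBlock.depth_lt {v x : V} {X : Finset V} (hX : T.IsBlock v X) (hx : x ∈ X) :
    T.depth x < T.depth v + X.card := by
  classical
  have key : ∀ x, x ∈ X → Finset.Icc (T.depth v) (T.depth x) ⊆ X.image T.depth := by
    intro x
    induction x using T.induction_parent with
    | root =>
      intro hx d hd
      have := hX.depth_le hx
      rw [Finset.mem_Icc] at hd
      exact Finset.mem_image.2 ⟨_, hx, by
        by_cases h : T.root = v
        · rw [← h] at hd; omega
        · exact absurd rfl (hX.closed _ hx h).1⟩
    | step x hr ih =>
      intro hx d hd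
      rw [Finset.mem_Icc] at hd
      by_cases hdx : d = T.depth x
      · exact Finset.mem_image.2 ⟨x, hx, hdx.symm⟩
      · have hxv : x ≠ v := by rintro rfl; omega
        refine ih (hX.closed x hx hxv).2 (Finset.mem_Icc.2 ⟨hd.1, ?_⟩)
        have := T.depth_parent hr
        omega
  have h₁ := Finset.card_le_card (key x hx)
  have h₂ := Finset.card_image_le (s := X) (f := T.depth)
  rw [Nat.card_Icc] at h₁
  omega

variable {T} in
theorem IsBlock.root_mem_iff {v : V} {X : Finset V} (hX : T.IsBlock v X) :
    T.root ∈ X ↔ T.root = v := by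
  constructor
  · intro h
    by_contra hne
    exact (hX.closed _ h hne).1 rfl
  · rintro rfl
    exact hX.mem

variable [DecidableEq V]

/-- The vertices lying immediately below a finite set of vertices. -/
def front (X : Finset V) : Finset V := X.biUnion T.children \ X

variable {T} in
theorem mem_front {X : Finset V} {p : V} :
    p ∈ T.front X ↔ p ∉ X ∧ p ≠ T.root ∧ T.parent p ∈ X := by
  simp only [front, Finset.mem_sdiff, Finset.mem_biUnion, T.mem_children]
  constructor
  · rintro ⟨⟨a, ha, h₁, rfl⟩, h₂⟩
    exact ⟨h₂, h₁, ha⟩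
  · rintro ⟨h₂, h₁, ha⟩
    exact ⟨⟨_, ha, h₁, rfl⟩, h₂⟩

variable {T} in
theorem IsBlock.insert_front {v p : V} {X : Finset V} (hX : T.IsBlock v X) (hp : p ∈ T.front X) :
    T.IsBlock v (insert p X) := by
  obtain ⟨-, h₂, h₃⟩ := mem_front.1 hp
  refine ⟨Finset.mem_insert_of_mem hX.mem, fun x hx hxv => ?_⟩
  rcases Finset.mem_insert.1 hx with rfl | hx
  · exact ⟨h₂, Finset.mem_insert_of_mem h₃⟩
  · exact (hX.closed x hx hxv).imp_right Finset.mem_insert_of_mem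

variable {T} in
theorem IsBlock.depth_lt_of_mem_front {v p : V} {X : Finset V} (hX : T.IsBlock v X)
    (hp : p ∈ T.front X) : T.depth v < T.depth p := by
  obtain ⟨-, h₂, h₃⟩ := mem_front.1 hp
  rw [T.depth_parent h₂]
  exact Nat.lt_succ_of_le (hX.depth_le h₃)

/-- Every vertex of the tree has valence `m + 2`. -/
def HasValence (m : ℕ) : Prop :=
  ∀ v, (T.children v).card = m + 1 + if T.root = v then 1 else 0

variable {T} in
theorem IsBlock.card_front {v : V} {X : Finset V} {m : ℕ} (hT : T.HasValence m)
    (hX : T.IsBlock v X) :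
    (T.front X).card = X.card * m + 1 + if T.root = v then 1 else 0 := by
  have h₁ : (X.biUnion T.children).card = X.card * (m + 1) + if T.root = v then 1 else 0 := by
    rw [Finset.card_biUnion (T.pairwiseDisjoint_children _), Finset.sum_congr rfl fun x _ => hT x,
      Finset.sum_add_distrib, Finset.sum_const, smul_eq_mul, Finset.sum_ite_eq]
    simp only [hX.root_mem_iff]
  have h₂ : X.erase v ⊆ X.biUnion T.children := fun x hx => by
    obtain ⟨hxv, hx⟩ := Finset.mem_erase.1 hx
    obtain ⟨h, h'⟩ := hX.closed x hx hxv
    exact Finset.mem_biUnion.2 ⟨_, h', T.mem_children.2 ⟨h, rfl⟩⟩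
  have h₃ : T.front X = X.biUnion T.children \ X.erase v := by
    ext p
    simp only [front, Finset.mem_sdiff, Finset.mem_erase, not_and]
    refine and_congr_right fun hp => ⟨fun h _ => h, fun h => h ?_⟩
    rintro rfl
    obtain ⟨x, hx, hpx⟩ := Finset.mem_biUnion.1 hp
    have := T.depth_of_mem_children hpx
    have := hX.depth_le hx
    omega
  have h₄ := Finset.card_sdiff_add_card_eq_card h₂
  rw [← h₃, h₁, Finset.card_erase_of_mem hX.mem] at h₄
  have := Finset.card_pos.2 ⟨v, hX.mem⟩
  rw [Nat.mul_add] at h₄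
  omega

/-- There are subtrees of any prescribed cardinality of logarithmic depth. -/
theorem exists_balanced_block (hT : ∀ v, 2 ≤ (T.children v).card) (u : V) (r k : ℕ)
    (hk : k + 1 ≤ 2 ^ r) :
    ∃ Y, T.IsBlock u Y ∧ Y.card = k + 1 ∧ ∀ y ∈ Y, T.depth y ≤ T.depth u + r := by
  induction k with
  | zero =>
    refine ⟨{u}, ⟨by simp, fun x hx hxu => absurd (Finset.mem_singleton.1 hx) hxu⟩, by simp, ?_⟩
    simp
  | succ k ih =>
    obtain ⟨Y, hY, hc, hd⟩ := ih (by omega)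
    by_cases hp : ∃ p ∈ T.front Y, T.depth p ≤ T.depth u + r
    · obtain ⟨p, hp, hpd⟩ := hp
      refine ⟨insert p Y, hY.insert_front hp, ?_, fun y hy => ?_⟩
      · rw [Finset.card_insert_of_notMem (mem_front.1 hp).1, hc]
      · rcases Finset.mem_insert.1 hy with rfl | hy
        · exact hpd
        · exact hd y hy
    · push Not at hp
      exfalso
      have level : ∀ i ≤ r, ∃ L : Finset V, L ⊆ Y ∧ 2 ^ i ≤ L.card ∧
          ∀ x ∈ L, T.depth x = T.depth u + i := by
        intro i
        induction i with
        | zero => exact fun _ => ⟨{u}, by simpa using hY.mem, by simp, by simp⟩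
        | succ i ih =>
          intro hi
          obtain ⟨L, hL, hLc, hLd⟩ := ih (by omega)
          have hdep : ∀ x ∈ L.biUnion T.children, T.depth x = T.depth u + (i + 1) := by
            intro x hx
            obtain ⟨y, hy, hxy⟩ := Finset.mem_biUnion.1 hx
            rw [T.depth_of_mem_children hxy, hLd y hy]
            omega
          refine ⟨L.biUnion T.children, fun x hx => ?_, ?_, hdep⟩
          · by_contra hxY
            obtain ⟨y, hy, hxy⟩ := Finset.mem_biUnion.1 hx
            have := hp x (Finset.mem_sdiff.2 ⟨Finset.mem_biUnion.2 ⟨y, hL hy, hxy⟩, hxY⟩)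
            have := hdep x hx
            omega
          · rw [Finset.card_biUnion (T.pairwiseDisjoint_children _), pow_succ]
            calc 2 ^ i * 2 ≤ L.card * 2 := Nat.mul_le_mul_right _ hLc
              _ ≤ _ := by
                rw [← smul_eq_mul]
                exact Finset.card_nsmul_le_sum _ _ _ fun x _ => hT x
      obtain ⟨L, hL, hLc, -⟩ := level r le_rfl
      have := Finset.card_le_card hL
      omega

/-- A subtree can be enlarged by a descending path leading to it. -/
theorem exists_block_of_path {next : V → V} (hn : ∀ v, next v ∈ T.children v) (i : ℕ) (v : V)
    (Y : Finset V) (hY : T.IsBlock (next^[i] v) Y) :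
    ∃ X, T.IsBlock v X ∧ Y ⊆ X ∧ X.card = Y.card + i ∧ T.front Y ⊆ T.front X ∧
      ∀ x ∈ X, x ∈ Y ∨ ∃ j < i, x = next^[j] v := by
  induction i generalizing v with
  | zero => exact ⟨Y, hY, subset_rfl, rfl, subset_rfl, fun x hx => Or.inl hx⟩
  | succ i ih =>
    obtain ⟨X, hX, hYX, hc, hf, hx⟩ := ih (next v) hY
    have hd := T.depth_of_mem_children (hn v)
    have hv : v ∉ X := fun h => by
      have := hX.depth_le h
      omega
    refine ⟨insert v X, ⟨Finset.mem_insert_self _ _, fun x hx hxv => ?_⟩,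
      hYX.trans (Finset.subset_insert _ _), ?_, fun p hp => ?_, fun x hx' => ?_⟩
    · have hx := Finset.mem_of_mem_insert_of_ne hx hxv
      by_cases hxn : x = next v
      · obtain ⟨h₁, h₂⟩ := T.mem_children.1 (hn v)
        rw [hxn, h₂]
        exact ⟨h₁, Finset.mem_insert_self _ _⟩
      · exact (hX.closed x hx hxn).imp_right Finset.mem_insert_of_mem
    · rw [Finset.card_insert_of_notMem hv, hc, Nat.add_assoc]
    · have hp := hf hp
      obtain ⟨h₁, h₂, h₃⟩ := mem_front.1 hp
      refine mem_front.2 ⟨fun h => ?_, h₂, Finset.mem_insert_of_mem h₃⟩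
      rcases Finset.mem_insert.1 h with rfl | h
      · have := hX.depth_lt_of_mem_front hp
        omega
      · exact h₁ h
    · rcases Finset.mem_insert.1 hx' with rfl | hx'
      · exact Or.inr ⟨0, by omega, rfl⟩
      · rcases hx x hx' with h | ⟨j, hj, rfl⟩
        · exact Or.inl h
        · exact Or.inr ⟨j + 1, by omega, rfl⟩

variable {T} in
theorem IsBlock.abs_height_sub_le {v x : V} {X : Finset V} (hX : T.IsBlock v X) (hx : x ∈ X)
    {h : V → ℝ} {D : ℝ} (hD : ∀ u, u ≠ T.root → |h u - h (T.parent u)| ≤ D) :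
    |h x - h v| ≤ (T.depth x - T.depth v : ℝ) * D := by
  induction x using T.induction_parent with
  | root =>
    by_cases h : T.root = v
    · simp [h]
    · exact absurd rfl (hX.closed _ hx h).1
  | step x hr ih =>
    by_cases hxv : x = v
    · simp [hxv]
    · have h₁ := ih (hX.closed x hx hxv).2
      have h₂ := hD x hr
      have h₃ := abs_sub_le (h x) (h (T.parent x)) (h v)
      rw [T.depth_parent hr]
      push_cast
      linarith

/-- From every vertex one can descend the rooted tree while never losing height and gaining
height `δ` over every two steps. -/
def Climbs (h : V → ℝ) (δ : ℝ) : Prop :=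
  ∃ next : V → V, ∀ v, next v ∈ T.children v ∧ h v ≤ h (next v) ∧ h v + δ ≤ h (next (next v))

theorem exists_climbing_block {h : V → ℝ} {δ D : ℝ} {m : ℕ} (hm : 1 ≤ m) (hT : T.HasValence m)
    (hδ : 0 < δ) (hc : T.Climbs h δ) (hD : ∀ u, u ≠ T.root → |h u - h (T.parent u)| ≤ D) (C : ℝ) :
    ∃ t₀ : ℕ, ∀ t ≥ t₀, ∀ v, ∃ X, T.IsBlock v X ∧ X.card = t ∧
      (∀ p ∈ T.front X, h v - D ≤ h p) ∧
      (T.front X).card ≤ 2 * ((T.front X).filter fun p => h v + C ≤ h p).card := by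
  obtain ⟨t₀, ht₀⟩ := exists_natLog_mul_add_le δ D (max C 0) hδ
  obtain ⟨next, hn⟩ := hc
  refine ⟨t₀ + 1, fun t ht v => ?_⟩
  have hD₀ : 0 ≤ D := by
    have h₁ := T.mem_children.1 (hn v).1
    exact (abs_nonneg _).trans (hD _ h₁.1)
  set J := t / 4 with hJ
  set r := Nat.log 2 t + 1 with hr
  have hmono : ∀ j, h v ≤ h (next^[j] v) := fun j => by
    induction j with
    | zero => rfl
    | succ j ih =>
      rw [Function.iterate_succ_apply']
      exact ih.trans (hn _).2.1
  have hgain : ∀ j : ℕ, h v + j * δ ≤ h (next^[2 * j] v) := fun j => by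
    induction j with
    | zero => simp
    | succ j ih =>
      rw [show 2 * (j + 1) = 2 * j + 1 + 1 by ring, Function.iterate_succ_apply',
        Function.iterate_succ_apply']
      have := (hn (next^[2 * j] v)).2.2
      push_cast
      linarith
  have hpow : t < 2 ^ r := Nat.lt_pow_succ_log_self (by norm_num) t
  obtain ⟨Y, hY, hYc, hYd⟩ := T.exists_balanced_block
    (fun v => by have := hT v; omega) (next^[2 * J] v) r (t - 2 * J - 1) (by omega)
  obtain ⟨X, hX, hYX, hXc, hf, hpath⟩ := T.exists_block_of_path (fun v => (hn v).1) _ _ _ hY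
  have hlow : ∀ y ∈ Y, h v + C + D ≤ h y ∧ h v + D ≤ h y := fun y hy => by
    have h₁ := hY.abs_height_sub_le hy hD
    have h₂ : (T.depth y : ℝ) ≤ T.depth (next^[2 * J] v) + r := by exact_mod_cast hYd y hy
    have h₃ : (T.depth y - T.depth (next^[2 * J] v) : ℝ) * D ≤ r * D :=
      mul_le_mul_of_nonneg_right (by linarith) hD₀
    have h₄ := hgain J
    have h₅ := ht₀ t (by omega)
    have h₆ := (abs_le.1 (h₁.trans h₃)).1
    have h₇ : (r : ℝ) = Nat.log 2 t + 1 := by rw [hr]; push_cast; ring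
    rw [h₇] at h₆
    have := le_max_left C 0
    have := le_max_right C 0
    constructor <;> linarith
  refine ⟨X, hX, by omega, fun p hp => ?_, ?_⟩
  · obtain ⟨-, h₁, h₂⟩ := mem_front.1 hp
    have h₃ := (abs_le.1 (hD p h₁)).1
    rcases hpath _ h₂ with h₄ | ⟨j, -, h₄⟩
    · linarith [(hlow _ h₄).2]
    · linarith [h₄ ▸ hmono j]
  · have h₁ : T.front Y ⊆ (T.front X).filter fun p => h v + C ≤ h p := fun p hp => by
      refine Finset.mem_filter.2 ⟨hf hp, ?_⟩
      obtain ⟨-, h₁, h₂⟩ := mem_front.1 hp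
      have h₃ := (abs_le.1 (hD p h₁)).1
      linarith [(hlow _ h₂).1]
    have h₂ := Finset.card_le_card h₁
    rw [hY.card_front hT] at h₂
    rw [hX.card_front hT, hXc]
    have h₃ : (Y.card + 2 * J) * m ≤ 2 * (Y.card * m) := by
      rw [← Nat.mul_assoc]
      exact Nat.mul_le_mul_right _ (by omega)
    split_ifs <;> omega

end ParentTree

/-- Two finite sets of equal size, at least half of each being distinguished, can be matched so
that no pair consists of two undistinguished elements. -/
theorem Finset.exists_matching {V W : Type*} [DecidableEq V] [DecidableEq W] {P : Finset V}
    {Q : Finset W} (hPQ : P.card = Q.card) (p : V → Prop) (q : W → Prop) [DecidablePred p]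
    [DecidablePred q] (hp : P.card ≤ 2 * (P.filter p).card) (hq : Q.card ≤ 2 * (Q.filter q).card) :
    ∃ e : P ≃ Q, ∀ x : P, p x ∨ q (e x) := by
  have h₁ := Finset.card_filter_add_card_filter_not (s := P) p
  let e₀ : P ≃ Q := Finset.equivOfCardEq hPQ
  obtain ⟨B, hBq, hB⟩ := Finset.exists_subset_card_eq
    (show (P.filter (¬ p ·)).card ≤ (Q.filter q).card by omega)
  let e₁ : P.filter (¬ p ·) ≃ B := Finset.equivOfCardEq hB.symm
  let f : P → W := fun x =>
    if hx : (x : V) ∈ P.filter (¬ p ·) then e₁ ⟨x, hx⟩ else e₀ x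
  have hf : ∀ (x : P) (hx : (x : V) ∈ P.filter (¬ p ·)), f x = e₁ ⟨x, hx⟩ := fun x hx => dif_pos hx
  have hfB : ∀ (x : P), (x : V) ∈ P.filter (¬ p ·) → f x ∈ Q.filter q := fun x hx => by
    rw [hf x hx]
    exact hBq (e₁ ⟨x, hx⟩).2
  obtain ⟨e, he⟩ := Set.MapsTo.exists_equiv_extend_of_card_eq (α := P) (t := Q)
    (by simpa using hPQ) (s := {x : P | (x : V) ∈ P.filter (¬ p ·)}) (f := f)
    (fun x hx => (Finset.mem_filter.1 (hfB x hx)).1) (fun x hx y hy hxy => by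
      rw [hf x hx, hf y hy] at hxy
      have := e₁.injective (Subtype.ext hxy)
      exact Subtype.ext (Subtype.mk.inj this))
  refine ⟨e, fun x => or_iff_not_imp_left.2 fun hx => ?_⟩
  have hx' : (x : V) ∈ P.filter (¬ p ·) := Finset.mem_filter.2 ⟨x.2, hx⟩
  rw [he x hx']
  exact (Finset.mem_filter.1 (hfB x hx')).2

section Correspondence

variable {V W : Type*} [DecidableEq V] [DecidableEq W]

/-- Compatible decompositions into finite blocks of two rooted trees: whenever `(a, b)` is an
admissible pair, `X a b` and `Y a b` are blocks below `a` and `b`, and `φ a b`, `ψ a b` are mutually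
inverse matchings, by admissible pairs, of the vertices immediately below these blocks. -/
structure BlockMatching (S : ParentTree V) (T : ParentTree W) (R : V → W → Prop) where
  X : V → W → Finset V
  Y : V → W → Finset W
  φ : V → W → V → W
  ψ : V → W → W → V
  block_left : ∀ a b, R a b → S.IsBlock a (X a b)
  block_right : ∀ a b, R a b → T.IsBlock b (Y a b)
  map_front : ∀ a b, R a b → ∀ p ∈ S.front (X a b), φ a b p ∈ T.front (Y a b)
  inv_front : ∀ a b, R a b → ∀ q ∈ T.front (Y a b), ψ a b q ∈ S.front (X a b)
  left_inv : ∀ a b, R a b → ∀ p ∈ S.front (X a b), ψ a b (φ a b p) = p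
  right_inv : ∀ a b, R a b → ∀ q ∈ T.front (Y a b), φ a b (ψ a b q) = q
  rel : ∀ a b, R a b → ∀ p ∈ S.front (X a b), R p (φ a b p)

namespace BlockMatching

variable {S : ParentTree V} {T : ParentTree W} {R : V → W → Prop}

/-- Exchange the roles of the two trees. -/
def symm (M : BlockMatching S T R) : BlockMatching T S (fun b a => R a b) where
  X b a := M.Y a b
  Y b a := M.X a b
  φ b a := M.ψ a b
  ψ b a := M.φ a b
  block_left b a := M.block_right a b
  block_right b a := M.block_left a b
  map_front b a := M.inv_front a b
  inv_front b a := M.map_front a b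
  left_inv b a := M.right_inv a b
  right_inv b a := M.left_inv a b
  rel b a hab q hq := by
    have := M.rel a b hab _ (M.inv_front a b hab q hq)
    rwa [M.right_inv a b hab q hq] at this

/-- `s` assigns to each vertex the pair of tops of the blocks associated with it. -/
def IsTop (M : BlockMatching S T R) (s : V → V × W) : Prop :=
  s S.root = (S.root, T.root) ∧ ∀ v, v ≠ S.root → s v =
    if v ∈ M.X (s (S.parent v)).1 (s (S.parent v)).2 then s (S.parent v)
    else (v, M.φ (s (S.parent v)).1 (s (S.parent v)).2 v)

theorem exists_isTop (M : BlockMatching S T R) : ∃ s, M.IsTop s :=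
  S.exists_rec (S.root, T.root) fun v x => if v ∈ M.X x.1 x.2 then x else (v, M.φ x.1 x.2 v)

variable {M : BlockMatching S T R} {s : V → V × W}

theorem IsTop.rel_and_mem (hs : M.IsTop s) (hR : R S.root T.root) (v : V) :
    R (s v).1 (s v).2 ∧ v ∈ M.X (s v).1 (s v).2 := by
  induction v using S.induction_parent with
  | root =>
    rw [hs.1]
    exact ⟨hR, (M.block_left _ _ hR).mem⟩
  | step v hv ih =>
    rw [hs.2 v hv]
    split_ifs with h
    · exact ⟨ih.1, h⟩
    · have hr := M.rel _ _ ih.1 v (ParentTree.mem_front.2 ⟨h, hv, ih.2⟩)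
      exact ⟨hr, (M.block_left _ _ hr).mem⟩

theorem IsTop.eq_of_mem (hs : M.IsTop s) {a : V} {b : W} (hR : R a b) (ha : s a = (a, b)) {x : V}
    (hx : x ∈ M.X a b) : s x = (a, b) := by
  induction x using S.induction_parent with
  | root =>
    by_cases h : S.root = a
    · rw [h, ha]
    · exact absurd rfl ((M.block_left _ _ hR).closed _ hx h).1
  | step x hr ih =>
    by_cases h : x = a
    · rw [h, ha]
    · rw [hs.2 x hr, ih ((M.block_left _ _ hR).closed _ hx h).2, if_pos hx]

theorem IsTop.swap_eq (hs : M.IsTop s) {t : W → W × V} (ht : M.symm.IsTop t)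
    (hR : R S.root T.root) (v : V) : t (s v).2 = (s v).swap := by
  induction v using S.induction_parent with
  | root => rw [hs.1, ht.1]; rfl
  | step v hv ih =>
    rw [hs.2 v hv]
    obtain ⟨h₁, h₂⟩ := hs.rel_and_mem hR (S.parent v)
    split_ifs with h
    · exact ih
    · have hv' : v ∈ S.front (M.X (s (S.parent v)).1 (s (S.parent v)).2) :=
        ParentTree.mem_front.2 ⟨h, hv, h₂⟩
      have hq := M.map_front _ _ h₁ v hv'
      obtain ⟨h₃, h₄, h₅⟩ := ParentTree.mem_front.1 hq
      have h₆ := ht.eq_of_mem h₁ ih h₅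
      rw [ht.2 _ h₄, h₆]
      exact (if_neg h₃).trans (congrArg (Prod.mk _) (M.left_inv _ _ h₁ v hv'))

theorem IsTop.eq_or_parent_mem (hs : M.IsTop s) (hR : R S.root T.root) {v : V} (hv : v ≠ S.root) :
    (s v).2 = (s (S.parent v)).2 ∨
      (s v).2 ∈ T.front (M.Y (s (S.parent v)).1 (s (S.parent v)).2) := by
  obtain ⟨h₁, h₂⟩ := hs.rel_and_mem hR (S.parent v)
  rw [hs.2 v hv]
  split_ifs with h
  · exact Or.inl rfl
  · exact Or.inr (M.map_front _ _ h₁ v (ParentTree.mem_front.2 ⟨h, hv, h₂⟩))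

end BlockMatching

/-- The edges of the graph are the pairs formed by a vertex and its parent. -/
def ParentTree.Spans (T : ParentTree V) (G : SimpleGraph V) : Prop :=
  ∀ u v, G.Adj u v ↔ (u ≠ T.root ∧ T.parent u = v) ∨ (v ≠ T.root ∧ T.parent v = u)

namespace ParentTree

variable {S : ParentTree V} {G : SimpleGraph V}

omit [DecidableEq V] in
theorem Spans.connected (hS : S.Spans G) : G.Connected := by
  have key (v : V) : G.Reachable v S.root := by
    induction v using S.induction_parent with
    | root => exact .refl _
    | step v hv ih =>
      have hadj : G.Adj v (S.parent v) := (hS _ _).2 (Or.inl ⟨hv, rfl⟩)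
      exact hadj.reachable.trans ih
  have : Nonempty V := ⟨S.root⟩
  exact ⟨fun u v => (key u).trans (key v).symm⟩

omit [DecidableEq V] in
theorem Spans.dist_le_of_isBlock (hS : S.Spans G) {v x : V} {X : Finset V} (hX : S.IsBlock v X)
    (hx : x ∈ X) : G.dist x v ≤ X.card := by
  have key : ∀ x, x ∈ X → G.dist x v + S.depth v ≤ S.depth x := by
    intro x
    induction x using S.induction_parent with
    | root =>
      intro hx
      by_cases h : S.root = v
      · simp [h]
      · exact absurd rfl (hX.closed _ hx h).1
    | step x hr ih =>
      intro hx
      by_cases hxv : x = v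
      · simp [hxv]
      · have h₁ := ih (hX.closed x hx hxv).2
        have h₂ := hS.connected.dist_triangle (u := x) (v := S.parent x) (w := v)
        have h₃ : G.dist x (S.parent x) = 1 :=
          SimpleGraph.dist_eq_one_iff_adj.2 ((hS _ _).2 (Or.inl ⟨hr, rfl⟩))
        have h₄ := S.depth_parent hr
        omega
  have := key x hx
  have := hX.depth_lt hx
  omega

theorem Spans.dist_le_of_mem_front (hS : S.Spans G) {v x : V} {X : Finset V} (hX : S.IsBlock v X)
    (hx : x ∈ S.front X) : G.dist x v ≤ X.card + 1 := by
  obtain ⟨-, h₁, h₂⟩ := mem_front.1 hx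
  have h₃ := hS.dist_le_of_isBlock hX h₂
  have h₄ := hS.connected.dist_triangle (u := x) (v := S.parent x) (w := v)
  have h₅ : G.dist x (S.parent x) = 1 :=
    SimpleGraph.dist_eq_one_iff_adj.2 ((hS _ _).2 (Or.inl ⟨h₁, rfl⟩))
  omega

end ParentTree

theorem SimpleGraph.Connected.dist_map_le {V W : Type*} {G : SimpleGraph V} {H : SimpleGraph W}
    (hG : G.Connected) (hH : H.Connected) {f : V → W} {K : ℕ}
    (hf : ∀ u v, G.Adj u v → H.dist (f u) (f v) ≤ K) (u v : V) :
    H.dist (f u) (f v) ≤ K * G.dist u v := by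
  obtain ⟨p, hp⟩ := hG.exists_walk_length_eq_dist u v
  rw [← hp]
  clear hp
  induction p with
  | nil => simp
  | cons h p ih =>
    rw [SimpleGraph.Walk.length_cons]
    have h₁ := hf _ _ h
    have h₂ := hH.dist_triangle (u := f _) (v := f _) (w := f _) |>.trans (Nat.add_le_add h₁ ih)
    rw [Nat.mul_add]
    omega

/-- A Lipschitz map with a Lipschitz coarse inverse is a quasi-isometry. -/
theorem isQuasiIsometry_of_coarse_inverse {V W : Type*} {G : SimpleGraph V} {H : SimpleGraph W}
    (hG : G.Connected) (hH : H.Connected) {f : V → W} {g : W → V} {K : ℕ}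
    (hf : ∀ u v, G.Adj u v → H.dist (f u) (f v) ≤ K)
    (hg : ∀ u v, H.Adj u v → G.dist (g u) (g v) ≤ K)
    (hgf : ∀ v, G.dist v (g (f v)) ≤ K) (hfg : ∀ w, H.dist w (f (g w)) ≤ K) :
    IsQuasiIsometry (fun u v => (G.dist u v : ℝ)) (fun u v => (H.dist u v : ℝ)) f := by
  refine ⟨K + 1, 2 * K, by simp, by positivity, fun u v => ⟨?_, ?_⟩, fun w => ⟨g w, ?_⟩⟩
  · have h₁ := hH.dist_map_le hG hg (f u) (f v)
    have h₂ := hG.dist_triangle (u := u) (v := g (f u)) (w := v)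
    have h₃ := hG.dist_triangle (u := g (f u)) (v := g (f v)) (w := v)
    have h₄ := hgf u
    have h₅ := hgf v
    rw [SimpleGraph.dist_comm] at h₅
    have h₆ : (G.dist u v : ℝ) ≤ K * H.dist (f u) (f v) + 2 * K := by
      exact_mod_cast (by omega : G.dist u v ≤ K * H.dist (f u) (f v) + 2 * K)
    rw [sub_le_iff_le_add, div_le_iff₀ (by positivity)]
    have h₇ : (0 : ℝ) ≤ H.dist (f u) (f v) := by positivity
    have h₈ : (0 : ℝ) ≤ K := by positivity
    nlinarith
  · have h₁ : (H.dist (f u) (f v) : ℝ) ≤ K * G.dist u v := by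
      exact_mod_cast hG.dist_map_le hH hf u v
    have h₇ : (0 : ℝ) ≤ G.dist u v := by positivity
    have h₈ : (0 : ℝ) ≤ K := by positivity
    nlinarith
  · have h₁ : (H.dist w (f (g w)) : ℝ) ≤ K := by exact_mod_cast hfg w
    have h₈ : (0 : ℝ) ≤ K := by positivity
    linarith

theorem BlockMatching.exists_isCOPQuasiIsometry {S : ParentTree V} {T : ParentTree W}
    {R : V → W → Prop} (M : BlockMatching S T R) (hR : R S.root T.root) {G : SimpleGraph V}
    {H : SimpleGraph W} (hS : S.Spans G) (hT : T.Spans H) {h : V → ℝ} {k : W → ℝ} {N : ℕ}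
    {D E : ℝ} (hX : ∀ a b, R a b → (M.X a b).card ≤ N) (hY : ∀ a b, R a b → (M.Y a b).card ≤ N)
    (hD : ∀ u, u ≠ S.root → |h u - h (S.parent u)| ≤ D) (hD₀ : 0 ≤ D)
    (hE : ∀ a b, R a b → |k b - h a| ≤ E) :
    ∃ f : V → W, IsCOPQuasiIsometry G h H k f := by
  obtain ⟨s, hs⟩ := M.exists_isTop
  obtain ⟨t, ht⟩ := M.symm.exists_isTop
  have hE₀ : 0 ≤ E := (abs_nonneg _).trans (hE _ _ hR)
  refine ⟨fun v => (s v).2, isQuasiIsometry_of_coarse_inverse hS.connected hT.connected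
    (g := fun w => (t w).2) (K := N + 1) ?_ ?_ ?_ ?_, 2 * (E + N * D), by positivity, ?_⟩
  · have key : ∀ v, v ≠ S.root → H.dist (s v).2 (s (S.parent v)).2 ≤ N + 1 := fun v hv => by
      have hr := (hs.rel_and_mem hR (S.parent v)).1
      rcases hs.eq_or_parent_mem hR hv with e | e
      · rw [e]; simp
      · exact (hT.dist_le_of_mem_front (M.block_right _ _ hr) e).trans
          (Nat.add_le_add_right (hY _ _ hr) 1)
    intro u v huv
    rcases (hS u v).1 huv with ⟨h₁, rfl⟩ | ⟨h₁, rfl⟩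
    · exact key _ h₁
    · rw [SimpleGraph.dist_comm]
      exact key _ h₁
  · have key : ∀ v, v ≠ T.root → G.dist (t v).2 (t (T.parent v)).2 ≤ N + 1 := fun v hv => by
      have hr := (ht.rel_and_mem hR (T.parent v)).1
      rcases ht.eq_or_parent_mem hR hv with e | e
      · rw [e]; simp
      · exact (hS.dist_le_of_mem_front (M.block_left _ _ hr) e).trans
          (Nat.add_le_add_right (hX _ _ hr) 1)
    intro u v huv
    rcases (hT u v).1 huv with ⟨h₁, rfl⟩ | ⟨h₁, rfl⟩
    · exact key _ h₁
    · rw [SimpleGraph.dist_comm]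
      exact key _ h₁
  · intro v
    obtain ⟨hr, hm⟩ := hs.rel_and_mem hR v
    simp only [hs.swap_eq ht hR v, Prod.snd_swap]
    exact (hS.dist_le_of_isBlock (M.block_left _ _ hr) hm).trans ((hX _ _ hr).trans (by omega))
  · intro w
    obtain ⟨hr, hm⟩ := ht.rel_and_mem hR w
    have := ht.swap_eq (M := M.symm) (t := s) hs hR w
    simp only [this, Prod.snd_swap]
    exact (hT.dist_le_of_isBlock (M.block_right _ _ hr) hm).trans ((hY _ _ hr).trans (by omega))
  · have key : ∀ v, |k (s v).2 - h v| ≤ E + N * D := fun v => by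
      obtain ⟨hr, hm⟩ := hs.rel_and_mem hR v
      have hb := M.block_left _ _ hr
      have h₁ := hb.abs_height_sub_le hm hD
      have h₂ : (S.depth v : ℝ) ≤ S.depth (s v).1 + N := by
        exact_mod_cast (hb.depth_lt hm).le.trans (Nat.add_le_add_left (hX _ _ hr) _)
      have h₃ : (S.depth v - S.depth (s v).1 : ℝ) * D ≤ N * D :=
        mul_le_mul_of_nonneg_right (by linarith) hD₀
      have h₄ := abs_sub_le (k (s v).2) (h (s v).1) (h v)
      rw [abs_sub_comm] at h₁
      linarith [hE _ _ hr]
    intro u v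
    have h₁ := abs_le.1 (key u)
    have h₂ := abs_le.1 (key v)
    exact abs_le.2 ⟨by linarith [h₁.1, h₁.2, h₂.1, h₂.2], by linarith [h₁.1, h₁.2, h₂.1, h₂.2]⟩

end Correspondence

section Ample

variable {V W : Type*} [DecidableEq V] [DecidableEq W]

/-- A rooted tree of constant valence at least three with a Lipschitz height function, in which one
can climb up and climb down along descending paths. -/
structure ParentTree.IsAmple (T : ParentTree V) (h : V → ℝ) (m : ℕ) (δ D : ℝ) : Prop where
  one_le : 1 ≤ m
  valence : T.HasValence m
  pos : 0 < δ
  lipschitz : ∀ u, u ≠ T.root → |h u - h (T.parent u)| ≤ D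
  up : T.Climbs h δ
  down : T.Climbs (fun v => -h v) δ

namespace ParentTree

variable {S : ParentTree V} {T : ParentTree W} {h : V → ℝ} {k : W → ℝ} {m m' : ℕ}
  {δ δ' D D' : ℝ}

theorem IsAmple.nonneg (hS : S.IsAmple h m δ D) : 0 ≤ D := by
  obtain ⟨next, hn⟩ := hS.up
  exact (abs_nonneg _).trans (hS.lipschitz _ (S.mem_children.1 (hn S.root).1).1)

theorem IsAmple.abs_height_sub_le (hS : S.IsAmple h m δ D) {v p : V} {X : Finset V}
    (hX : S.IsBlock v X) (hp : p ∈ S.front X) : |h p - h v| ≤ (X.card + 1) * D := by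
  obtain ⟨-, h₁, h₂⟩ := mem_front.1 hp
  have h₃ := hX.abs_height_sub_le h₂ hS.lipschitz
  have h₄ : (S.depth (S.parent p) : ℝ) ≤ S.depth v + X.card := by
    exact_mod_cast (hX.depth_lt h₂).le
  have h₅ : (S.depth (S.parent p) - S.depth v : ℝ) * D ≤ X.card * D :=
    mul_le_mul_of_nonneg_right (by linarith) hS.nonneg
  linarith [abs_sub_le (h p) (h (S.parent p)) (h v), hS.lipschitz p h₁]

theorem IsAmple.exists_block_pair (hS : S.IsAmple h m δ D) (hT : T.IsAmple k m' δ' D') :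
    ∃ t₀ : ℕ, ∀ t ≥ t₀, ∀ E : ℝ, (t * m' + 1) * D + (t * m + 1) * D' ≤ E →
      ∀ a b, (S.root = a ↔ T.root = b) → h a ≤ k b → k b - h a ≤ E →
      ∃ X Y, S.IsBlock a X ∧ T.IsBlock b Y ∧ X.card = t * m' ∧ Y.card = t * m ∧
        ∃ e : S.front X ≃ T.front Y, ∀ x : S.front X, |k (e x) - h x| ≤ E := by
  obtain ⟨t₁, ht₁⟩ := S.exists_climbing_block hS.one_le hS.valence hS.pos hS.up hS.lipschitz D'
  obtain ⟨t₂, ht₂⟩ := T.exists_climbing_block hT.one_le hT.valence hT.pos hT.down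
    (D := D') (fun u hu => by
      rw [← abs_neg]
      convert hT.lipschitz u hu using 2
      ring) D
  refine ⟨t₁ + t₂, fun t ht E hE a b hab hle hsub => ?_⟩
  have hm := hS.one_le
  have hm' := hT.one_le
  obtain ⟨X, hX, hXc, hXl, hXg⟩ := ht₁ (t * m') (by nlinarith) a
  obtain ⟨Y, hY, hYc, hYl, hYg⟩ := ht₂ (t * m) (by nlinarith) b
  have hcard : (S.front X).card = (T.front Y).card := by
    rw [hX.card_front hS.valence, hY.card_front hT.valence, hXc, hYc]
    simp only [hab]
    ring
  obtain ⟨e, he⟩ := Finset.exists_matching hcard _ _ hXg hYg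
  refine ⟨X, Y, hX, hY, hXc, hYc, e, fun x => abs_le.2 ⟨?_, ?_⟩⟩
  · have h₁ := (abs_le.1 (hS.abs_height_sub_le hX x.2)).2
    have h₂ := (abs_le.1 (hT.abs_height_sub_le hY (e x).2)).1
    rw [hXc] at h₁
    rw [hYc] at h₂
    push_cast at h₁ h₂
    linarith
  · have h₁ := hXl x x.2
    have h₂ := hYl (e x) (e x).2
    have := hS.nonneg
    have := hT.nonneg
    rcases he x with h₃ | h₃ <;> linarith

theorem IsAmple.exists_isCOPQuasiIsometry (hS : S.IsAmple h m δ D) (hT : T.IsAmple k m' δ' D')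
    {G : SimpleGraph V} {H : SimpleGraph W} (hSG : S.Spans G) (hTH : T.Spans H) :
    ∃ f : V → W, IsCOPQuasiIsometry G h H k f := by
  obtain ⟨t₁, ht₁⟩ := hS.exists_block_pair hT
  obtain ⟨t₂, ht₂⟩ := hT.exists_block_pair hS
  set t := t₁ + t₂
  set E := max ((t * m' + 1) * D + (t * m + 1) * D') |k T.root - h S.root| with hE
  let R : V → W → Prop := fun a b => (S.root = a ↔ T.root = b) ∧ |k b - h a| ≤ E
  have key : ∀ a b, ∃ (X : Finset V) (Y : Finset W) (φ : V → W) (ψ : W → V), R a b →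
      S.IsBlock a X ∧ T.IsBlock b Y ∧ X.card ≤ t * (m + m') ∧ Y.card ≤ t * (m + m') ∧
      (∀ p ∈ S.front X, φ p ∈ T.front Y) ∧ (∀ q ∈ T.front Y, ψ q ∈ S.front X) ∧
      (∀ p ∈ S.front X, ψ (φ p) = p) ∧ (∀ q ∈ T.front Y, φ (ψ q) = q) ∧
      ∀ p ∈ S.front X, R p (φ p) := by
    intro a b
    by_cases hab : R a b
    swap
    · exact ⟨∅, ∅, fun _ => b, fun _ => a, fun h => absurd h hab⟩
    obtain ⟨X, Y, hX, hY, hXc, hYc, e, he⟩ : ∃ X Y, S.IsBlock a X ∧ T.IsBlock b Y ∧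
        X.card = t * m' ∧ Y.card = t * m ∧
        ∃ e : S.front X ≃ T.front Y, ∀ x : S.front X, |k (e x) - h x| ≤ E := by
      rcases le_total (h a) (k b) with hle | hle
      · exact ht₁ t (Nat.le_add_right _ _) E (le_max_left _ _) a b hab.1 hle
          ((le_abs_self _).trans hab.2)
      · obtain ⟨Y, X, hY, hX, hYc, hXc, e, he⟩ := ht₂ t (Nat.le_add_left _ _) E
          (by rw [add_comm]; exact le_max_left _ _) b a hab.1.symm hle
          (by rw [← neg_sub]; exact (neg_le_abs _).trans hab.2)
        refine ⟨X, Y, hX, hY, hXc, hYc, e.symm, fun x => ?_⟩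
        have := he (e.symm x)
        rwa [Equiv.apply_symm_apply, abs_sub_comm] at this
    refine ⟨X, Y, fun p => if hp : p ∈ S.front X then e ⟨p, hp⟩ else b,
      fun q => if hq : q ∈ T.front Y then e.symm ⟨q, hq⟩ else a, fun _ => ⟨hX, hY, ?_, ?_,
      fun p hp => ?_, fun q hq => ?_, fun p hp => ?_, fun q hq => ?_, fun p hp => ?_⟩⟩
    · rw [hXc]; exact Nat.mul_le_mul_left _ (by omega)
    · rw [hYc]; exact Nat.mul_le_mul_left _ (by omega)
    · simp only [dif_pos hp]; exact (e _).2
    · simp only [dif_pos hq]; exact (e.symm _).2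
    · simp [hp]
    · simp [hq]
    · simp only [dif_pos hp]
      exact ⟨iff_of_false (mem_front.1 hp).2.1.symm (mem_front.1 (e ⟨p, hp⟩).2).2.1.symm, he _⟩
  choose X Y φ ψ hM using key
  let M : BlockMatching S T R :=
    { X, Y, φ, ψ
      block_left a b hab := (hM a b hab).1
      block_right a b hab := (hM a b hab).2.1
      map_front a b hab := (hM a b hab).2.2.2.2.1
      inv_front a b hab := (hM a b hab).2.2.2.2.2.1
      left_inv a b hab := (hM a b hab).2.2.2.2.2.2.1
      right_inv a b hab := (hM a b hab).2.2.2.2.2.2.2.1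
      rel a b hab := (hM a b hab).2.2.2.2.2.2.2.2 }
  exact M.exists_isCOPQuasiIsometry ⟨by simp, le_max_right _ _⟩ hSG hTH
    (N := t * (m + m')) (fun a b hab => (hM a b hab).2.2.1) (fun a b hab => (hM a b hab).2.2.2.1)
    hS.lipschitz hS.nonneg (fun a b hab => hab.2)

end ParentTree

end Ample

section Rooting

variable {V : Type*} {G : SimpleGraph V}

theorem ParentTree.exists_spans {o : V} (depth : V → ℕ) (ho : depth o = 0)
    (hG : ∀ u, u ≠ o → ∃ p, G.Adj u p ∧ depth u = depth p + 1 ∧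
      ∀ q, G.Adj u q → q ≠ p → depth q = depth u + 1)
    (hlf : ∀ v, (G.neighborSet v).Finite) : ∃ T : ParentTree V, T.root = o ∧ T.Spans G := by
  classical
  choose! p hadj hdepth hp using hG
  refine ⟨{ root := o, parent := p, depth := depth,
            children v := (hlf v).toFinset.filter fun u => u ≠ o ∧ p u = v,
            mem_children {u v} := ?_, depth_parent hu := hdepth _ hu }, rfl, fun u v => ?_⟩
  · simp only [Finset.mem_filter, Set.Finite.mem_toFinset, SimpleGraph.mem_neighborSet,
      and_iff_right_iff_imp]
    rintro ⟨hu, rfl⟩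
    exact (hadj u hu).symm
  · constructor
    · intro h
      by_contra! hc
      by_cases hu : u = o
      · subst hu
        have := hp v h.ne' u h.symm (hc.2 h.ne').symm
        omega
      · have h₁ := hp u hu v h (hc.1 hu).symm
        have hv : v ≠ o := by rintro rfl; omega
        have h₂ := hp v hv u h.symm (hc.2 hv).symm
        omega
    · rintro (⟨h, rfl⟩ | ⟨h, rfl⟩)
      · exact hadj u h
      · exact (hadj v h).symm

theorem SimpleGraph.IsTree.exists_parentTree (hG : G.IsTree)
    (hlf : ∀ v, (G.neighborSet v).Finite) (o : V) :
    ∃ T : ParentTree V, T.root = o ∧ T.Spans G := by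
  refine ParentTree.exists_spans (G.dist o) (by simp) (fun u hu => ?_) hlf
  have hpath (p : V) (hp : G.Adj p u) (h : G.dist o u = G.dist o p + 1) :
      ∃ P : G.Path o u, P.1.penultimate = p := by
    obtain ⟨w, hw⟩ := hG.connected.exists_walk_length_eq_dist o p
    refine ⟨⟨w.concat hp, SimpleGraph.Walk.isPath_of_length_eq_dist _ ?_⟩, by simp⟩
    rw [SimpleGraph.Walk.length_concat, hw, h]
  obtain ⟨w, hw⟩ := hG.connected.exists_walk_length_eq_dist o u
  have hnil : ¬ w.Nil := fun h => hu h.eq.symm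
  have hp := w.adj_penultimate hnil
  have hd : G.dist o u = G.dist o w.penultimate + 1 := by
    have h₁ := SimpleGraph.dist_le w.dropLast
    have h₂ := w.length_dropLast_add_one hnil
    rcases hG.dist_eq_dist_add_one_of_adj o hp with h | h <;> omega
  refine ⟨w.penultimate, hp.symm, hd, fun q hq hne => ?_⟩
  refine (hG.dist_eq_dist_add_one_of_adj o hq).resolve_left fun h => hne ?_
  obtain ⟨P, hP⟩ := hpath q hq.symm h
  obtain ⟨Q, hQ⟩ := hpath _ hp hd
  rw [← hP, ← hQ, (hG.isAcyclic.subsingleton_path o u).elim P Q]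

theorem ParentTree.Spans.hasValence [DecidableEq V] {T : ParentTree V} (hT : T.Spans G) {m : ℕ}
    (hm : ∀ v, (G.neighborSet v).ncard = m + 2) : T.HasValence m := by
  intro v
  have h := hm v
  by_cases hv : T.root = v
  · rw [if_pos hv]
    have : G.neighborSet v = T.children v := by
      ext u
      rw [SimpleGraph.mem_neighborSet, hT, Finset.mem_coe, T.mem_children]
      simp [hv]
    rwa [this, Set.ncard_coe_finset] at h
  · rw [if_neg hv]
    have hnot : T.parent v ∉ T.children v := fun hc => by
      have h₁ := T.depth_of_mem_children hc
      have h₂ := T.depth_parent (Ne.symm hv)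
      omega
    have : G.neighborSet v = (insert (T.parent v) (T.children v) : Finset V) := by
      ext u
      rw [SimpleGraph.mem_neighborSet, hT, Finset.mem_coe, Finset.mem_insert, T.mem_children,
        eq_comm (a := u)]
      simp [Ne.symm hv]
    rw [this, Set.ncard_coe_finset, Finset.card_insert_of_notMem hnot] at h
    omega

end Rooting

section Homogeneous

variable {V : Type*} {G : SimpleGraph V} {h : V → ℝ}

theorem Homogeneous.exists_adj (hG : Homogeneous G h) {P : ℝ → Prop} {v u : V} (hu : G.Adj v u)
    (hP : P (h u - h v)) (w : V) : ∃ u, G.Adj w u ∧ P (h u - h w) := by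
  obtain ⟨σ, hσ⟩ := hG v w
  exact ⟨σ ⟨u, hu⟩, (σ ⟨u, hu⟩).2, hσ ⟨u, hu⟩ ▸ hP⟩

theorem Homogeneous.exists_adj_pair (hG : Homogeneous G h) {P : ℝ → Prop} {v u₁ u₂ : V}
    (hne : u₁ ≠ u₂) (h₁ : G.Adj v u₁) (h₂ : G.Adj v u₂) (hP₁ : P (h u₁ - h v))
    (hP₂ : P (h u₂ - h v)) (w : V) :
    ∃ u₁ u₂, u₁ ≠ u₂ ∧ (G.Adj w u₁ ∧ P (h u₁ - h w)) ∧ (G.Adj w u₂ ∧ P (h u₂ - h w)) := by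
  obtain ⟨σ, hσ⟩ := hG v w
  refine ⟨σ ⟨u₁, h₁⟩, σ ⟨u₂, h₂⟩, fun e => hne ?_, ⟨(σ ⟨u₁, h₁⟩).2, hσ ⟨u₁, h₁⟩ ▸ hP₁⟩,
    ⟨(σ ⟨u₂, h₂⟩).2, hσ ⟨u₂, h₂⟩ ▸ hP₂⟩⟩
  exact congrArg Subtype.val (σ.injective (Subtype.ext e))

theorem Homogeneous.exists_bounds (hG : Homogeneous G h) (hlf : ∀ v, (G.neighborSet v).Finite)
    (o : V) : ∃ δ D : ℝ, 0 < δ ∧ (∀ v u, G.Adj v u → h u ≠ h v → δ ≤ |h u - h v|) ∧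
      ∀ v u, G.Adj v u → |h u - h v| ≤ D := by
  obtain ⟨D, hD⟩ := ((hlf o).image fun u => |h u - h o|).bddAbove
  obtain ⟨δ, hδ, hδ₀⟩ : ∃ δ : ℝ, (∀ u ∈ G.neighborSet o, h u ≠ h o → δ ≤ |h u - h o|) ∧ 0 < δ := by
    have : ∀ᶠ δ : ℝ in nhdsWithin 0 (Set.Ioi 0),
        ∀ u ∈ G.neighborSet o, h u ≠ h o → δ ≤ |h u - h o| := by
      refine (Filter.eventually_all_finite (hlf o)).2 fun u _ => ?_
      by_cases hu : h u = h o
      · simp [hu]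
      · have hpos := abs_pos.2 (sub_ne_zero.2 hu)
        filter_upwards [nhdsWithin_le_nhds (Iic_mem_nhds hpos)] with δ hδ _
        exact hδ
    exact (this.and self_mem_nhdsWithin).exists
  refine ⟨δ, D, hδ₀, fun v u hu hne => ?_, fun v u hu => ?_⟩ <;>
    obtain ⟨σ, hσ⟩ := hG v o <;> specialize hσ ⟨u, hu⟩ <;> dsimp only at hσ <;> rw [hσ]
  · refine hδ _ (σ ⟨u, hu⟩).2 fun e => hne ?_
    rwa [e, sub_self, sub_eq_zero] at hσ
  · exact hD ⟨_, (σ ⟨u, hu⟩).2, rfl⟩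

namespace ParentTree

variable {T : ParentTree V}

theorem Spans.mem_children (hT : T.Spans G) {v u : V} (hu : G.Adj v u) :
    u ∈ T.children v ∨ v ≠ T.root ∧ u = T.parent v := by
  rcases (hT v u).1 hu with ⟨h₁, h₂⟩ | ⟨h₁, h₂⟩
  · exact Or.inr ⟨h₁, h₂.symm⟩
  · exact Or.inl (T.mem_children.2 ⟨h₁, h₂⟩)

theorem Spans.climbs (hT : T.Spans G) {δ : ℝ}
    (hδ : ∀ v u, G.Adj v u → h v < h u → h v + δ ≤ h u) (hup : ∀ v, ∃ u, G.Adj v u ∧ h v < h u)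
    (hex : ∀ v, (∃ u, G.Adj v u ∧ h u = h v) ∨
      ∃ u₁ u₂, u₁ ≠ u₂ ∧ (G.Adj v u₁ ∧ h v < h u₁) ∧ G.Adj v u₂ ∧ h v < h u₂) :
    T.Climbs h δ := by
  have key (v : V) : ∃ c ∈ T.children v, h v ≤ h c ∧
      (h v < h c ∨ h c = h v ∧ ∀ u ∈ T.children v, ¬ h v < h u) := by
    by_cases hc : ∃ c ∈ T.children v, h v < h c
    · obtain ⟨c, hc, hlt⟩ := hc
      exact ⟨c, hc, hlt.le, Or.inl hlt⟩
    · push Not at hc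
      have hpar {u : V} (hu : G.Adj v u) (hlt : h v < h u) : u = T.parent v :=
        ((hT.mem_children hu).resolve_left fun hm => (hc u hm).not_gt hlt).2
      rcases hex v with ⟨u, hu, he⟩ | ⟨u₁, u₂, hne, h₁, h₂⟩
      · obtain ⟨w, hw, hlt⟩ := hup v
        refine ⟨u, (hT.mem_children hu).resolve_right fun hm => ?_, he.ge,
          Or.inr ⟨he, fun u hu => (hc u hu).not_gt⟩⟩
        rw [hpar hw hlt, ← hm.2, he] at hlt
        exact lt_irrefl _ hlt
      · exact absurd ((hpar h₁.1 h₁.2).trans (hpar h₂.1 h₂.2).symm) hne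
  choose next hmem hle hnext using key
  have hadj (v : V) : G.Adj v (next v) := (hT _ _).2 (Or.inr (T.mem_children.1 (hmem v)))
  refine ⟨next, fun v => ⟨hmem v, hle v, ?_⟩⟩
  rcases hnext v with hlt | ⟨he, -⟩
  · exact (hδ _ _ (hadj v) hlt).trans (hle _)
  · rw [← he]
    refine hδ _ _ (hadj _) ((hnext (next v)).resolve_right fun hc => ?_)
    obtain ⟨u, hu, hlt⟩ := hup (next v)
    rcases hT.mem_children hu with hm | ⟨-, hm⟩
    · exact hc.2 u hm hlt
    · rw [hm, (T.mem_children.1 (hmem v)).2, he] at hlt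
      exact lt_irrefl _ hlt

/-- A rooted homogeneous tree is ample as soon as some vertex has a higher neighbor, a lower
neighbor, and either a neighbor of the same height or two higher and two lower neighbors. -/
theorem Spans.exists_isAmple [DecidableEq V] (hT : T.Spans G) (hG : Homogeneous G h)
    (hlf : ∀ v, (G.neighborSet v).Finite) {o u d : V} (hu : G.Adj o u) (hlu : h o < h u)
    (hd : G.Adj o d) (hld : h d < h o)
    (hex : (∃ z, G.Adj o z ∧ h z = h o) ∨
      (∃ u', u ≠ u' ∧ G.Adj o u' ∧ h o < h u') ∧ ∃ d', d ≠ d' ∧ G.Adj o d' ∧ h d' < h o) :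
    ∃ m δ D, T.IsAmple h m δ D := by
  obtain ⟨δ, D, hδ, hgap, hlip⟩ := hG.exists_bounds hlf T.root
  have hcard : 3 ≤ (G.neighborSet o).ncard := by
    obtain ⟨z, hz, hzu, hzd⟩ : ∃ z, G.Adj o z ∧ z ≠ u ∧ z ≠ d := by
      rcases hex with ⟨z, hz, he⟩ | ⟨⟨z, hne, hz, hlt⟩, -⟩
      · exact ⟨z, hz, by rintro rfl; exact hlu.ne' he, by rintro rfl; exact hld.ne he⟩
      · exact ⟨z, hz, hne.symm, by rintro rfl; exact hlt.not_gt hld⟩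
    exact (Set.two_lt_ncard_iff (hlf o)).2 ⟨z, u, d, hz, hu, hd, hzu, hzd, by
      rintro rfl; exact hlu.not_gt hld⟩
  obtain ⟨m, hm⟩ : ∃ m, (G.neighborSet o).ncard = m + 2 := ⟨_, (Nat.sub_add_cancel (by omega)).symm⟩
  refine ⟨m, δ, D, by omega, hT.hasValence fun v => ?_, hδ, fun v hv => ?_, ?_, ?_⟩
  · obtain ⟨σ, -⟩ := hG v o
    rw [← hm]
    exact Nat.card_congr σ
  · exact hlip _ _ ((hT _ _).2 (Or.inr ⟨hv, rfl⟩))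
  · refine hT.climbs (fun v u hu hlt => ?_) (fun v => ?_) fun v => ?_
    · have := hgap v u hu hlt.ne'
      rw [abs_of_pos (sub_pos.2 hlt)] at this
      linarith
    · simpa using hG.exists_adj (P := (0 < ·)) hu (by simpa using hlu) v
    · rcases hex with ⟨z, hz, he⟩ | ⟨⟨u', hne, hu', hlt⟩, -⟩
      · left
        simpa [sub_eq_zero] using hG.exists_adj (P := (· = 0)) hz (by simpa [sub_eq_zero]) v
      · right
        simpa using hG.exists_adj_pair (P := (0 < ·)) hne hu hu'
          (by simpa using hlu) (by simpa using hlt) v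
  · refine hT.climbs (fun v u hu hlt => ?_) (fun v => ?_) fun v => ?_
    · have := hgap v u hu (neg_lt_neg_iff.1 hlt).ne
      rw [abs_of_neg (sub_neg.2 (neg_lt_neg_iff.1 hlt))] at this
      linarith
    · simpa using hG.exists_adj (P := (· < 0)) hd (by simpa using hld) v
    · rcases hex with ⟨z, hz, he⟩ | ⟨-, d', hne, hd', hlt⟩
      · left
        simpa [sub_eq_zero] using hG.exists_adj (P := (· = 0)) hz (by simpa [sub_eq_zero]) v
      · right
        simpa using hG.exists_adj_pair (P := (· < 0)) hne hd hd'
          (by simpa using hld) (by simpa using hlt) v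

end ParentTree

end Homogeneous

section FreeTree

open FreeGroup

theorem FreeGroup.toWord_mul_mk_singleton {α : Type*} [DecidableEq α] (g : FreeGroup α)
    (x : α × Bool) : (g * mk [x]).toWord = g.toWord ++ [x] ∨
      g.toWord = (g * mk [x]).toWord ++ [(x.1, !x.2)] := by
  have hred := isReduced_toWord (x := g)
  have hmul : (g * mk [x]).toWord = reduce (g.toWord ++ [x]) := by
    rw [toWord_mul, toWord_mk, reduce_singleton]
  rcases List.eq_nil_or_concat' g.toWord with he | ⟨L, y, he⟩
  · left
    rw [hmul, he, List.nil_append, reduce_singleton]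
  · rw [he] at hred
    by_cases hxy : y.1 = x.1 → y.2 = x.2
    · left
      have : IsReduced (g.toWord ++ [x]) := by
        rw [he]
        exact IsReduced.append_overlap (L₂ := [y]) (L₃ := [x]) hred
          (by simpa [IsReduced] using hxy) (by simp)
      rw [hmul, this.reduce_eq]
    · right
      push Not at hxy
      obtain ⟨h₁, h₂⟩ := hxy
      obtain rfl : y = (x.1, !x.2) := Prod.ext h₁ (by simpa using Bool.eq_not_of_ne h₂)
      have hg : g * mk [x] = mk L := by
        rw [← mk_toWord (x := g), he, mul_mk, List.append_assoc]
        exact Quot.sound (by simpa using Red.Step.not (L₁ := L) (L₂ := []) (x := x.1) (b := !x.2))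
      rw [he, hg, toWord_mk, IsReduced.reduce_eq hred.left_of_append]

theorem T22_adj_iff {g g' : FreeGroup Bool} :
    T22.Adj g g' ↔ ∃ x : Bool × Bool, g' = g * mk [x] := by
  have hinv (i : Bool) : mk [(i, false)] = (of i)⁻¹ := by simp [of, invRev]
  rw [T22, SimpleGraph.fromRel_adj]
  constructor
  · rintro ⟨-, ⟨i, rfl⟩ | ⟨i, rfl⟩⟩
    · exact ⟨(i, true), rfl⟩
    · exact ⟨(i, false), by rw [hinv, mul_inv_cancel_right]⟩
  · rintro ⟨⟨i, b⟩, rfl⟩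
    refine ⟨fun h => ?_, ?_⟩
    · simpa using congrArg toWord (left_eq_mul.1 h)
    · cases b
      · exact Or.inr ⟨i, by rw [hinv, inv_mul_cancel_right]⟩
      · exact Or.inl ⟨i, rfl⟩

theorem h22_mul (g g' : FreeGroup Bool) : h22 (g * g') = h22 g + h22 g' := by
  simp [h22]

theorem h22_inv (g : FreeGroup Bool) : h22 g⁻¹ = -h22 g := by
  simp [h22]

theorem h22_mk_singleton (x : Bool × Bool) : h22 (mk [x]) = if x.2 then 1 else -1 := by
  obtain ⟨i, b⟩ := x
  cases b <;> simp [h22]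

theorem h22_of_pow (i : Bool) (n : ℕ) : h22 (of i ^ n) = n := by
  simp [h22]

theorem finite_neighborSet_T22 (g : FreeGroup Bool) : (T22.neighborSet g).Finite :=
  (Set.finite_range fun x : Bool × Bool => g * mk [x]).subset fun u hu => by
    obtain ⟨x, hx⟩ := T22_adj_iff.1 hu
    exact ⟨x, hx.symm⟩

theorem homogeneous_T22 : Homogeneous T22 h22 := by
  intro v w
  refine ⟨(Equiv.mulLeft (w * v⁻¹)).subtypeEquiv fun u => ?_, fun u => ?_⟩
  · simp only [SimpleGraph.mem_neighborSet, T22_adj_iff, Equiv.coe_mulLeft, mul_assoc,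
      mul_right_inj, inv_mul_eq_iff_eq_mul]
  · simp [h22_mul, h22_inv, sub_eq_neg_add]

theorem exists_spans_T22 : ∃ T : ParentTree (FreeGroup Bool), T.root = 1 ∧ T.Spans T22 := by
  refine ParentTree.exists_spans norm norm_one (fun u hu => ?_) finite_neighborSet_T22
  obtain ⟨L, x, hL⟩ := (List.eq_nil_or_concat' u.toWord).resolve_left (by simpa using hu)
  have hux : u = mk L * mk [x] := by rw [mul_mk, ← hL, mk_toWord]
  have hword : u.toWord = (mk L).toWord ++ [x] := by
    rw [hux]
    refine (toWord_mul_mk_singleton _ x).resolve_right fun h => ?_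
    have h₁ := congrArg List.length h
    have h₂ := congrArg List.length hL
    have h₃ : (mk L).toWord.length ≤ L.length := norm_mk_le
    rw [← hux] at h₁
    simp only [List.length_append, List.length_singleton] at h₁ h₂
    omega
  refine ⟨mk L, (T22_adj_iff.2 ⟨x, hux⟩).symm, by simp [FreeGroup.norm, hword], fun q hq hne => ?_⟩
  obtain ⟨y, rfl⟩ := T22_adj_iff.1 hq
  rcases toWord_mul_mk_singleton u y with h | h
  · simp [FreeGroup.norm, h]
  · exact absurd (toWord_injective (List.append_inj_left' (h.symm.trans hword) rfl)) hne

theorem exists_isAmple_T22 :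
    ∃ (T : ParentTree (FreeGroup Bool)) (m : ℕ) (δ D : ℝ), T.Spans T22 ∧ T.IsAmple h22 m δ D := by
  obtain ⟨T, -, hT⟩ := exists_spans_T22
  have hadj (x : Bool × Bool) : T22.Adj 1 (mk [x]) := T22_adj_iff.2 ⟨x, (one_mul _).symm⟩
  have hne (b : Bool) : (mk [(true, b)] : FreeGroup Bool) ≠ mk [(false, b)] := fun h => by
    simpa using congrArg toWord h
  have h1 : h22 1 = 0 := by simp [h22]
  obtain ⟨m, δ, D, h⟩ := hT.exists_isAmple homogeneous_T22 finite_neighborSet_T22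
    (hadj (true, true)) (by norm_num [h1, h22_mk_singleton]) (hadj (true, false))
    (by norm_num [h1, h22_mk_singleton]) (Or.inr
      ⟨⟨_, hne true, hadj _, by norm_num [h1, h22_mk_singleton]⟩,
        ⟨_, hne false, hadj _, by norm_num [h1, h22_mk_singleton]⟩⟩)
  exact ⟨T, m, δ, D, hT, h⟩

theorem connected_T22 : T22.Connected := by
  obtain ⟨T, -, hT⟩ := exists_spans_T22
  exact hT.connected

theorem SimpleGraph.Connected.abs_sub_le_dist {V : Type*} {G : SimpleGraph V} (hG : G.Connected)
    {f : V → ℝ} (hf : ∀ u v, G.Adj u v → |f u - f v| ≤ 1) (u v : V) :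
    |f u - f v| ≤ G.dist u v := by
  obtain ⟨p, hp⟩ := hG.exists_walk_length_eq_dist u v
  rw [← hp]
  clear hp
  induction p with
  | nil => simp
  | @cons u v w h p ih =>
    rw [SimpleGraph.Walk.length_cons]
    push_cast
    linarith [abs_sub_le (f u) (f v) (f w), hf _ _ h]

theorem abs_h22_sub_le_dist (g g' : FreeGroup Bool) : |h22 g - h22 g'| ≤ T22.dist g g' := by
  refine connected_T22.abs_sub_le_dist (fun g g' h => ?_) g g'
  obtain ⟨x, rfl⟩ := T22_adj_iff.1 h
  rw [h22_mul, h22_mk_singleton]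
  split_ifs <;> simp

theorem h22_mk_replicate (n : ℕ) (x : Bool × Bool) :
    h22 (mk (List.replicate n x)) = n * if x.2 then 1 else -1 := by
  induction n with
  | zero => simp [h22, ← one_eq_mk]
  | succ n ih =>
    rw [List.replicate_succ, ← List.singleton_append, ← mul_mk, h22_mul, ih, h22_mk_singleton]
    push_cast
    ring

/-- The first letter of the reduced word is a power of the generator `true`. -/
def StartsWithTrue (g : FreeGroup Bool) : Prop :=
  ∃ b, g.toWord.head? = some (true, b)

theorem abs_h22_le_dist {g g' : FreeGroup Bool} (hg : StartsWithTrue g)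
    (hg' : ¬ StartsWithTrue g') : |h22 g| ≤ T22.dist g g' := by
  classical
  let f (g : FreeGroup Bool) : ℝ := if StartsWithTrue g then h22 g else 0
  have key (g g' : FreeGroup Bool) (x : Bool × Bool) (hadj : T22.Adj g g')
      (h : g'.toWord = g.toWord ++ [x]) : |f g - f g'| ≤ 1 := by
    have hsub := abs_h22_sub_le_dist g g'
    rw [SimpleGraph.dist_eq_one_iff_adj.2 hadj, Nat.cast_one] at hsub
    by_cases h1 : g = 1
    · have : h22 g = 0 := by simp [h1, h22]
      rw [this, zero_sub, abs_neg] at hsub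
      simp only [f, this, ite_self, zero_sub, abs_neg]
      split_ifs
      · exact hsub
      · simp
    · have : StartsWithTrue g' ↔ StartsWithTrue g := by
        rw [StartsWithTrue, StartsWithTrue, h, List.head?_append_of_ne_nil _ (by simpa using h1)]
      simp only [f, this]
      split_ifs
      · exact hsub
      · simp
  have := connected_T22.abs_sub_le_dist (f := f) (fun g g' h => by
    obtain ⟨x, hx⟩ := T22_adj_iff.1 h
    rcases toWord_mul_mk_singleton g x with h' | h'
    · exact key _ _ _ h (hx ▸ h')
    · rw [abs_sub_comm]
      exact key _ _ _ h.symm (hx ▸ h')) g g'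
  simpa [f, hg, hg'] using this

theorem startsWithTrue_mk_replicate {n : ℕ} (hn : n ≠ 0) (i b : Bool) :
    StartsWithTrue (mk (List.replicate n (i, b))) ↔ i = true := by
  simp [StartsWithTrue, toWord_mk, reduce_replicate, List.head?_replicate, hn]

end FreeTree

section Exclusion

variable {V : Type*} {G : SimpleGraph V} {h : V → ℝ}

theorem IsCOPQuasiIsometry.exists_lt {f : V → FreeGroup Bool}
    (hf : IsCOPQuasiIsometry G h T22 h22 f) : ∃ u v, h u < h v := by
  obtain ⟨⟨K, C, -, -, -, hdense⟩, C', -, hC'⟩ := hf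
  obtain ⟨n, hn⟩ := exists_nat_gt (2 * C + C')
  obtain ⟨x, hx⟩ := hdense 1
  obtain ⟨y, hy⟩ := hdense (FreeGroup.of true ^ n)
  refine ⟨x, y, ?_⟩
  have h₁ := (abs_le.1 ((abs_h22_sub_le_dist _ _).trans hx)).1
  have h₂ := (abs_le.1 ((abs_h22_sub_le_dist _ _).trans hy)).2
  have h₃ := (abs_le.1 (hC' x y)).2
  rw [h22_of_pow] at h₂
  have : h22 1 = 0 := by simp [h22]
  linarith

theorem SimpleGraph.Connected.exists_iterate_eq (hG : G.Connected) {up : V → V}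
    (hup : ∀ u v, G.Adj u v → v = up u ∨ u = up v) (u v : V) :
    ∃ i j, up^[i] u = up^[j] v := by
  obtain ⟨p⟩ := hG u v
  induction p with
  | nil => exact ⟨0, 0, rfl⟩
  | cons h p ih =>
    obtain ⟨i, j, hij⟩ := ih
    rcases hup _ _ h with rfl | rfl
    · exact ⟨i + 1, j, hij⟩
    · cases i with
      | zero => exact ⟨0, j + 1, by rw [Function.iterate_succ_apply', ← hij]; rfl⟩
      | succ i => exact ⟨i, j, hij⟩

/-- A tree in which every vertex has a single higher neighbor admits no quasi-isometry to the tree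
of type `(2,2)` which coarsely preserves, or coarsely reverses, height changes. -/
theorem not_exists_quasiIsometry_of_unique_higher (hG : G.Connected)
    (hh : ∀ v, (∃! u, G.Adj v u ∧ h v < h u) ∧ ∀ u, G.Adj v u → h u ≠ h v) (b : Bool)
    {f : V → FreeGroup Bool}
    (hf : IsQuasiIsometry (fun u v => (G.dist u v : ℝ)) (fun u v => (T22.dist u v : ℝ)) f)
    {C' : ℝ} (hC' : ∀ u v,
      |(if b then 1 else -1) * (h22 (f v) - h22 (f u)) - (h v - h u)| ≤ C') : False := by
  obtain ⟨K, C, hK, hC, hdist, hdense⟩ := hf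
  beta_reduce at hdist hdense
  choose up hup huniq using fun v => (hh v).1
  obtain ⟨n, hn⟩ := exists_nat_gt (K + 2 * C + C')
  set s : ℝ := if b then 1 else -1 with hs
  have hs₁ : s * s = 1 := by rw [hs]; split_ifs <;> norm_num
  have hs₂ : |s| = 1 := by rw [hs]; split_ifs <;> norm_num
  have hC'₀ : 0 ≤ C' := (abs_nonneg _).trans (hC' (hG.nonempty.some) hG.nonempty.some)
  have hn₀ : n ≠ 0 := by
    rintro rfl
    rw [Nat.cast_zero] at hn
    linarith
  have hmem {x y : V} (hxy : G.Adj x y) : y = up x ∨ x = up y := by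
    rcases ((hh x).2 y hxy).lt_or_gt with hlt | hlt
    · exact Or.inr (huniq y x ⟨hxy.symm, hlt⟩)
    · exact Or.inl (huniq x y ⟨hxy, hlt⟩)
  have habs (g : FreeGroup Bool) : s * h22 g ≤ |h22 g| :=
    (le_abs_self _).trans (by rw [abs_mul, hs₂, one_mul])
  have horbit {x : V} (hx : K + C + C' < s * h22 (f x)) (i : ℕ) :
      StartsWithTrue (f (up^[i] x)) ↔ StartsWithTrue (f x) := by
    have hle (i : ℕ) : h x ≤ h (up^[i] x) := by
      induction i with
      | zero => rfl
      | succ i ih => rw [Function.iterate_succ_apply']; exact ih.trans (hup _).2.le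
    have hbig (i : ℕ) : K + C < |h22 (f (up^[i] x))| := by
      have h₁ := (abs_le.1 (hC' x (up^[i] x))).1
      linarith [hle i, habs (f (up^[i] x))]
    induction i with
    | zero => rfl
    | succ i ih =>
      refine Iff.trans ?_ ih
      have h₁ := (hdist (up^[i] x) (up^[i + 1] x)).2
      have h₂ : G.dist (up^[i] x) (up^[i + 1] x) = 1 := by
        rw [Function.iterate_succ_apply']
        exact SimpleGraph.dist_eq_one_iff_adj.2 (hup _).1
      rw [h₂, Nat.cast_one, mul_one] at h₁
      constructor <;> intro h₃ <;> by_contra h₄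
      · rw [SimpleGraph.dist_comm] at h₁
        exact ((abs_h22_le_dist h₃ h₄).trans h₁).not_gt (hbig _)
      · exact ((abs_h22_le_dist h₃ h₄).trans h₁).not_gt (hbig _)
  have hpoint (i : Bool) : ∃ x, K + C + C' < s * h22 (f x) ∧
      (StartsWithTrue (f x) ↔ i = true) := by
    obtain ⟨x, hx⟩ := hdense (FreeGroup.mk (List.replicate n (i, b)))
    have h₁ : s * h22 (FreeGroup.mk (List.replicate n (i, b))) = n := by
      rw [h22_mk_replicate, ← hs]
      linear_combination (n : ℝ) * hs₁
    have h₂ := habs (FreeGroup.mk (List.replicate n (i, b)))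
    have h₃ : K + C + C' < s * h22 (f x) := by
      have := (abs_h22_sub_le_dist _ _).trans hx
      rw [← one_mul |_|, ← hs₂, ← abs_mul, mul_sub, h₁] at this
      linarith [(abs_le.1 this).2]
    refine ⟨x, h₃, ?_⟩
    rw [← startsWithTrue_mk_replicate hn₀ i b]
    constructor <;> intro h₄ <;> by_contra h₅
    · rw [SimpleGraph.dist_comm] at hx
      linarith [abs_h22_le_dist h₄ h₅, habs (f x)]
    · linarith [abs_h22_le_dist h₄ h₅]
  obtain ⟨x, hx, hx'⟩ := hpoint true
  obtain ⟨y, hy, hy'⟩ := hpoint false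
  obtain ⟨i, j, hij⟩ := hG.exists_iterate_eq (fun _ _ => hmem) x y
  have h₁ := horbit hx i
  rw [hij, horbit hy j, hx', hy'] at h₁
  simp at h₁

theorem Homogeneous.exists_ne_or_existsUnique (hG : Homogeneous G h) {P : ℝ → Prop} {o u : V}
    (hu : G.Adj o u) (hP : P (h u - h o)) :
    (∃ u', u ≠ u' ∧ G.Adj o u' ∧ P (h u' - h o)) ∨ ∀ v, ∃! u, G.Adj v u ∧ P (h u - h v) := by
  by_contra! hc
  obtain ⟨hc, v, hv⟩ := hc
  obtain ⟨w, hw⟩ := hG.exists_adj hu hP v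
  refine hv ⟨w, hw, fun w' hw' => by_contra fun hne => ?_⟩
  obtain ⟨u₁, u₂, hne', h₁, h₂⟩ := hG.exists_adj_pair hne hw'.1 hw.1 hw'.2 hw.2 o
  by_cases e : u = u₁
  · exact hc u₂ (e ▸ hne') h₂.1 h₂.2
  · exact hc u₁ e h₁.1 h₁.2

theorem exists_isCOPQuasiIsometry_T22 (hT : G.IsTree) (hlf : ∀ v, (G.neighborSet v).Finite)
    (hhom : Homogeneous G h) (hconst : ¬ ∀ u v, h u = h v)
    (hhoro : ¬ ((∀ v, (∃! u, G.Adj v u ∧ h v < h u) ∧ ∀ u, G.Adj v u → h u ≠ h v) ∨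
      ∀ v, (∃! u, G.Adj v u ∧ h u < h v) ∧ ∀ u, G.Adj v u → h u ≠ h v)) :
    ∃ f : V → FreeGroup Bool, IsCOPQuasiIsometry G h T22 h22 f := by
  classical
  obtain ⟨o, u, hu, hlu⟩ : ∃ o u, G.Adj o u ∧ h o < h u := by
    by_contra! hc
    refine hconst fun u v => ?_
    obtain ⟨p⟩ := hT.connected u v
    induction p with
    | nil => rfl
    | cons hadj p ih => exact (le_antisymm (hc _ _ hadj.symm) (hc _ _ hadj)).trans ih
  obtain ⟨d, hd, hld⟩ := hhom.exists_adj (P := (· < 0)) hu.symm (sub_neg.2 hlu) o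
  rw [sub_neg] at hld
  obtain ⟨S, -, hS⟩ := hT.exists_parentTree hlf o
  obtain ⟨m, δ, D, hS'⟩ := hS.exists_isAmple hhom hlf hu hlu hd hld <| by
    by_contra! hc
    obtain ⟨hz, hc⟩ := hc
    have hne (v w : V) (hw : G.Adj v w) : h w ≠ h v := fun e => by
      obtain ⟨z, hz', he⟩ := hhom.exists_adj (P := (· = 0)) hw (sub_eq_zero.2 e) o
      exact hz z hz' (sub_eq_zero.1 he)
    rcases hhom.exists_ne_or_existsUnique (P := (0 < ·)) hu (sub_pos.2 hlu) with h₁ | h₁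
    · rcases hhom.exists_ne_or_existsUnique (P := (· < 0)) hd (sub_neg.2 hld) with h₂ | h₂
      · simp only [sub_pos, sub_neg] at h₁ h₂
        obtain ⟨d', h₃, h₄, h₅⟩ := h₂
        exact (hc h₁ d' h₃ h₄).not_gt h₅
      · exact hhoro (Or.inr fun v => ⟨by simpa only [sub_neg] using h₂ v, hne v⟩)
    · exact hhoro (Or.inl fun v => ⟨by simpa only [sub_pos] using h₁ v, hne v⟩)
  obtain ⟨T, m', δ', D', hT', hT''⟩ := exists_isAmple_T22
  exact hS'.exists_isCOPQuasiIsometry hT'' hS hT'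

end Exclusion

/-- Classification of homogeneous coarsely oriented trees: exactly one of (1) the
height is constant; (2) every vertex has exactly one strictly higher neighbor and all
its other neighbors strictly lower, or vice versa; (3) `T` is coarsely orientation
preserving quasi-isometric to the oriented tree of type `(2,2)`. -/
theorem homogeneous_tree_trichotomy {V : Type*} (G : SimpleGraph V) (h : V → ℝ)
    (hT : G.IsTree) (hlf : ∀ v, (G.neighborSet v).Finite) (hhom : Homogeneous G h) :
    (((∀ u v : V, h u = h v)) ∧
      ¬((∀ v : V, (∃! u, G.Adj v u ∧ h v < h u) ∧ ∀ u, G.Adj v u → h u ≠ h v) ∨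
        (∀ v : V, (∃! u, G.Adj v u ∧ h u < h v) ∧ ∀ u, G.Adj v u → h u ≠ h v)) ∧
      ¬(∃ f : V → FreeGroup Bool, IsCOPQuasiIsometry G h T22 h22 f)) ∨
    ((¬(∀ u v : V, h u = h v)) ∧
      ((∀ v : V, (∃! u, G.Adj v u ∧ h v < h u) ∧ ∀ u, G.Adj v u → h u ≠ h v) ∨
        (∀ v : V, (∃! u, G.Adj v u ∧ h u < h v) ∧ ∀ u, G.Adj v u → h u ≠ h v)) ∧
      ¬(∃ f : V → FreeGroup Bool, IsCOPQuasiIsometry G h T22 h22 f)) ∨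
    ((¬(∀ u v : V, h u = h v)) ∧
      ¬((∀ v : V, (∃! u, G.Adj v u ∧ h v < h u) ∧ ∀ u, G.Adj v u → h u ≠ h v) ∨
        (∀ v : V, (∃! u, G.Adj v u ∧ h u < h v) ∧ ∀ u, G.Adj v u → h u ≠ h v)) ∧
      (∃ f : V → FreeGroup Bool, IsCOPQuasiIsometry G h T22 h22 f)) := by
  have not_const (hc : (∀ v : V, (∃! u, G.Adj v u ∧ h v < h u) ∧ ∀ u, G.Adj v u → h u ≠ h v) ∨
      ∀ v : V, (∃! u, G.Adj v u ∧ h u < h v) ∧ ∀ u, G.Adj v u → h u ≠ h v) :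
      ¬ ∀ u v : V, h u = h v := fun hconst => by
    obtain ⟨o⟩ := hT.connected.nonempty
    rcases hc with hc | hc <;> obtain ⟨⟨u, hu, -⟩, hne⟩ := hc o <;> exact hne u hu.1 (hconst u o)
  have not_qi (hc : (∀ v : V, (∃! u, G.Adj v u ∧ h v < h u) ∧ ∀ u, G.Adj v u → h u ≠ h v) ∨
      ∀ v : V, (∃! u, G.Adj v u ∧ h u < h v) ∧ ∀ u, G.Adj v u → h u ≠ h v) :
      ¬ ∃ f : V → FreeGroup Bool, IsCOPQuasiIsometry G h T22 h22 f := by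
    rintro ⟨f, hf, C', -, hC'⟩
    rcases hc with hc | hc
    · exact not_exists_quasiIsometry_of_unique_higher hT.connected hc true hf (C' := C')
        (by simpa using hC')
    · refine not_exists_quasiIsometry_of_unique_higher (h := fun v => -h v) hT.connected
        (by simpa using hc) false hf (C' := C') fun u v => ?_
      rw [← abs_neg]
      convert hC' u v using 2
      simp only [Bool.false_eq_true, if_false]
      ring
  by_cases hconst : ∀ u v : V, h u = h v
  · refine Or.inl ⟨hconst, fun hc => not_const hc hconst, ?_⟩
    rintro ⟨f, hf⟩
    obtain ⟨u, v, hlt⟩ := hf.exists_lt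
    exact hlt.ne (hconst u v)
  · by_cases hc : (∀ v : V, (∃! u, G.Adj v u ∧ h v < h u) ∧ ∀ u, G.Adj v u → h u ≠ h v) ∨
        ∀ v : V, (∃! u, G.Adj v u ∧ h u < h v) ∧ ∀ u, G.Adj v u → h u ≠ h v
    · exact Or.inr (Or.inl ⟨hconst, hc, not_qi hc⟩)
    · exact Or.inr (Or.inr ⟨hconst, hc, exists_isCOPQuasiIsometry_T22 hT hlf hhom hconst hc⟩)
end
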